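/- arXiv:1305.2986 — 3 statements merged into one kernel-verified Lean document; each statement's English description precedes it below -/
import Mathlib

section
/- Let ε, C > 0 and let G be an undirected graph with n vertices, m ≤ Cn edges, maximum degree Δ, and τ odd components. Then there is a partition V = T1 ∪ ⋯ ∪ Ts ∪ U of the vertex set such that: (i) each Ti induces a star with 2 ≤ |Ti| ≤ Δ+1; (ii) all but at most one non-apex vertex of each Ti has degree (in G) at most 2C/ε; and (iii) U is an independent set with |U| ≤ τ + εn. -/
open Finset

namespace StarAux

/-- parity of the degree of `v` in the edge set `S` -/
noncomputable def par {V : Type*} [DecidableEq V] (S : Finset (Sym2 V)) (v : V) : ZMod 2 :=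
  ∑ e ∈ S, if v ∈ e then 1 else 0

lemma par_symmDiff {V : Type*} [DecidableEq V] (S T : Finset (Sym2 V)) (v : V) :
    par (symmDiff S T) v = par S v + par T v := by
  unfold par
  have h1 : ∀ A B : Finset (Sym2 V), ∑ e ∈ A, (if v ∈ e then (1 : ZMod 2) else 0) =
      ∑ e ∈ A \ B, (if v ∈ e then (1 : ZMod 2) else 0)
        + ∑ e ∈ A ∩ B, (if v ∈ e then (1 : ZMod 2) else 0) := by
    intro A B
    rw [add_comm, Finset.sum_inter_add_sum_sdiff]
  have h2 : symmDiff S T = (S \ T) ∪ (T \ S) := rfl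
  rw [h2, Finset.sum_union (by
    rw [Finset.disjoint_left]; intro e he; simp only [Finset.mem_sdiff] at *; tauto),
    h1 S T, h1 T S, Finset.inter_comm T S]
  have h3 : ∀ a b c : ZMod 2, a + b = a + c + (b + c) := by decide
  exact h3 _ _ _

lemma par_single {V : Type*} [DecidableEq V] {x y : V} (h : x ≠ y) (v : V) :
    par {s(x, y)} v = (if v = x then 1 else 0) + (if v = y then 1 else 0) := by
  unfold par
  rw [Finset.sum_singleton]
  by_cases h1 : v = x
  · subst h1; simp [h]
  · simp [h1]

lemma exists_path {V : Type*} [Fintype V] [DecidableEq V] (G : SimpleGraph V)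
    [DecidableRel G.Adj] {x y : V} (w : G.Walk x y) :
    ∃ P ⊆ G.edgeFinset, ∀ v, par P v = (if v = x then 1 else 0) + (if v = y then 1 else 0) := by
  have h2 : ∀ a : ZMod 2, a + a = 0 := by decide
  induction w with
  | nil => exact ⟨∅, by simp, fun v => by rw [h2]; simp [par]⟩
  | @cons a b c hab p ih =>
    obtain ⟨P, hP, hpar⟩ := ih
    refine ⟨symmDiff {s(a, b)} P, ?_, ?_⟩
    · intro e he
      rw [Finset.mem_symmDiff] at he
      rcases he with he | he
      · have := he.1
        rw [Finset.mem_singleton] at this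
        subst this
        simpa using hab
      · exact hP he.1
    · intro v
      rw [par_symmDiff, hpar, par_single hab.ne]
      have h3 : ∀ a b c : ZMod 2, a + b + (b + c) = a + c := by decide
      exact h3 _ _ _

/-- the set of vertices of even degree -/
noncomputable def ev {V : Type*} [Fintype V] [DecidableEq V] (S : Finset (Sym2 V)) : Finset V :=
  univ.filter (fun v => par S v = 0)

lemma exists_S {V : Type*} [Fintype V] [DecidableEq V] (G : SimpleGraph V)
    [DecidableRel G.Adj] :
    ∃ S ⊆ G.edgeFinset, (∀ x y z, s(x, y) ∈ S → s(x, z) ∈ S → ¬ G.Adj y z) ∧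
      (ev S).card ≤ Nat.card {c : G.ConnectedComponent // Odd (Nat.card c.supp)} := by
  classical
  obtain ⟨S0, hS0, hmin0⟩ := Finset.exists_min_image G.edgeFinset.powerset
    (fun S => (ev S).card) ⟨∅, by simp⟩
  obtain ⟨S, hS, hmin⟩ := Finset.exists_min_image
    (G.edgeFinset.powerset.filter (fun S => (ev S).card = (ev S0).card))
    Finset.card ⟨S0, by simp [Finset.mem_powerset.1 hS0]⟩
  rw [Finset.mem_filter, Finset.mem_powerset] at hS
  obtain ⟨hS, hcard⟩ := hS
  refine ⟨S, hS, ?_, ?_⟩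
  · intro x y z hxy hxz hyz
    have hxy' : x ≠ y := by
      have := hS hxy; simp at this; exact this.ne
    have hxz' : x ≠ z := by
      have := hS hxz; simp at this; exact this.ne
    set T : Finset (Sym2 V) := symmDiff {s(x, y)} (symmDiff {s(x, z)} {s(y, z)}) with hT
    have hpar : ∀ v, par (symmDiff S T) v = par S v := by
      intro v
      rw [par_symmDiff, hT, par_symmDiff, par_symmDiff, par_single hxy', par_single hxz',
        par_single hyz.ne]
      have h3 : ∀ p a b c : ZMod 2, p + (a + b + (a + c + (b + c))) = p := by decide
      exact h3 _ _ _ _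
    have hev : ev (symmDiff S T) = ev S := by
      unfold ev; simp only [hpar]
    have hsub : symmDiff S T ⊆ ((S.erase s(x, y)).erase s(x, z)) ∪ {s(y, z)} := by
      intro e he
      have n1 : s(x, y) ≠ s(x, z) := by
        intro h; rw [Sym2.congr_right] at h; exact hyz.ne h
      have n2 : s(x, y) ≠ s(y, z) := by
        intro h; simp at h; grind
      have n3 : s(x, z) ≠ s(y, z) := by
        intro h; simp at h; grind
      simp only [hT, Finset.mem_symmDiff, Finset.mem_singleton, Finset.mem_union,
        Finset.mem_erase] at he ⊢
      generalize s(x, y) = a at *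
      generalize s(x, z) = b at *
      generalize s(y, z) = c at *
      by_cases h1 : e = a <;> by_cases h2 : e = b <;> by_cases h3 : e = c <;> grind
    have hc1 := Finset.card_le_card hsub
    have hc2 := Finset.card_union_le ((S.erase s(x, y)).erase s(x, z)) {s(y, z)}
    have hc3 : ((S.erase s(x, y)).erase s(x, z)).card + 1 = (S.erase s(x, y)).card := by
      apply Finset.card_erase_add_one
      rw [Finset.mem_erase]
      refine ⟨?_, hxz⟩
      intro h; rw [Sym2.congr_right] at h; exact hyz.ne h.symm
    have hc4 : (S.erase s(x, y)).card + 1 = S.card := Finset.card_erase_add_one hxy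
    rw [Finset.card_singleton] at hc2
    have := hmin (symmDiff S T) (by
      rw [Finset.mem_filter, Finset.mem_powerset, hev]
      refine ⟨?_, hcard⟩
      intro e he
      have := hsub he
      simp only [Finset.mem_union, Finset.mem_erase, Finset.mem_singleton] at this
      rcases this with h | h
      · exact hS h.2.2
      · subst h; simpa using hyz)
    omega
  · have huniq : ∀ x ∈ ev S, ∀ y ∈ ev S, G.Reachable x y → x = y := by
      intro x hx y hy hr
      by_contra hne
      obtain ⟨w⟩ := hr
      obtain ⟨P, hP, hpar⟩ := exists_path G w
      have hx' : par S x = 0 := by simpa [ev] using hx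
      have hy' : par S y = 0 := by simpa [ev] using hy
      have hlt : (ev (symmDiff S P)).card < (ev S).card := by
        apply Finset.card_lt_card
        rw [Finset.ssubset_iff_of_subset]
        · refine ⟨x, hx, ?_⟩
          simp [ev, par_symmDiff, hpar, hx', hne]
        · intro v hv
          simp only [ev, Finset.mem_filter, Finset.mem_univ, true_and, par_symmDiff, hpar] at hv ⊢
          by_cases h1 : v = x
          · subst h1; exact hx'
          by_cases h2 : v = y
          · subst h2; exact hy'
          simpa [h1, h2] using hv
      have := hmin0 (symmDiff S P) (by
        rw [Finset.mem_powerset]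
        intro e he
        rw [Finset.mem_symmDiff] at he
        rcases he with h | h
        · exact hS h.1
        · exact hP h.1)
      omega
    have hodd : ∀ x ∈ ev S, Odd (Nat.card (G.connectedComponentMk x).supp) := by
      intro x hx
      set c : Finset V := univ.filter (fun v => G.connectedComponentMk v = G.connectedComponentMk x)
        with hc
      have hcc : Nat.card (G.connectedComponentMk x).supp = c.card := by
        rw [Nat.card_eq_fintype_card, Fintype.card_subtype]
        congr 1
        ext v
        simp [hc, SimpleGraph.ConnectedComponent.mem_supp_iff]
      have hxc : x ∈ c := by simp [hc]
      have hsum : ∑ w ∈ c, par S w = 0 := by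
        unfold par
        rw [Finset.sum_comm]
        apply Finset.sum_eq_zero
        intro e he
        have he' := hS he
        induction e with
        | h a b =>
          rw [SimpleGraph.mem_edgeFinset, SimpleGraph.mem_edgeSet] at he'
          have hab : G.connectedComponentMk a = G.connectedComponentMk b :=
            SimpleGraph.ConnectedComponent.sound he'.reachable
          have : ∀ w, (if w ∈ s(a, b) then (1 : ZMod 2) else 0) =
            (if w = a then 1 else 0) + (if w = b then 1 else 0) := by
            intro w
            have := par_single he'.ne w
            rw [← this, par, Finset.sum_singleton]
          simp only [this, Finset.sum_add_distrib, Finset.sum_ite_eq', hc, Finset.mem_filter,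
            Finset.mem_univ, true_and, hab]
          split_ifs <;> decide
      have hsum2 : ∑ w ∈ c, par S w = ((c.erase x).card : ZMod 2) := by
        rw [← Finset.add_sum_erase _ _ hxc]
        have hx' : par S x = 0 := by simpa [ev] using hx
        rw [hx', zero_add, Finset.sum_congr rfl (g := fun _ => (1 : ZMod 2))]
        · simp
        · intro w hw
          rw [Finset.mem_erase] at hw
          have h1 : par S w ≠ 0 := by
            intro h
            refine hw.1 (huniq w (by simp [ev, h]) x hx ?_)
            have := hw.2
            simp only [hc, Finset.mem_filter, Finset.mem_univ, true_and] at this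
            exact SimpleGraph.ConnectedComponent.exact this
          have h2 : ∀ a : ZMod 2, a ≠ 0 → a = 1 := by decide
          exact h2 _ h1
      rw [hsum2, ZMod.natCast_eq_zero_iff] at hsum
      have := Finset.card_erase_add_one hxc
      rw [hcc, ← this]
      exact (even_iff_two_dvd.2 hsum).add_one
    have := Nat.card_le_card_of_injective
      (fun x : ev S => (⟨G.connectedComponentMk x.1, hodd x.1 x.2⟩ :
        {c : G.ConnectedComponent // Odd (Nat.card c.supp)})) (by
          rintro ⟨x, hx⟩ ⟨y, hy⟩ h
          simp only [Subtype.mk.injEq] at h ⊢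
          exact huniq x hx y hy (SimpleGraph.ConnectedComponent.exact h))
    simpa using this

/-- vertices in trivial fibres of `f` -/
def un {V : Type*} [Fintype V] [DecidableEq V] (f : V → V) : Finset V :=
  univ.filter (fun v => ∀ w, f w = v ↔ w = v)

lemma mem_un {V : Type*} [Fintype V] [DecidableEq V] {f : V → V} {v : V} :
    v ∈ un f ↔ ∀ w, f w = v ↔ w = v := by simp [un]

lemma exists_f {V : Type*} [Fintype V] [DecidableEq V] (r : V → V → Prop)
    (hsymm : ∀ x y, r x y → r y x) :
    ∃ f : V → V, (∀ v, f (f v) = f v) ∧ (∀ v, f v ≠ v → r v (f v)) ∧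
      ∀ v ∈ un f, ∀ w, w ≠ v → ¬ r v w := by
  classical
  obtain ⟨f, hf, hmin⟩ := Finset.exists_min_image
    ((univ : Finset (V → V)).filter (fun f => (∀ v, f (f v) = f v) ∧ (∀ v, f v ≠ v → r v (f v))))
    (fun f => (un f).card) ⟨id, by simp⟩
  simp only [Finset.mem_filter, Finset.mem_univ, true_and] at hf hmin
  obtain ⟨hid, hr⟩ := hf
  refine ⟨f, hid, hr, ?_⟩
  intro u hu w hwu huw
  have key : ∀ g : V → V, (∀ v, g (g v) = g v) → (∀ v, g v ≠ v → r v (g v)) →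
      u ∉ un g → (∀ v ∈ un g, v ∈ un f) → False := by
    intro g h1 h2 h3 h4
    have := hmin g ⟨h1, h2⟩
    have : (un g).card < (un f).card := Finset.card_lt_card (by
      rw [Finset.ssubset_iff_of_subset h4]; exact ⟨u, hu, h3⟩)
    omega
  rw [mem_un] at hu
  have hfu := (hu u).2 rfl
  by_cases hw : f w = w
  · refine key (fun v => if v = u then w else f v) ?_ ?_ ?_ ?_
    · intro v; grind
    · intro v; grind
    · rw [mem_un]; grind
    · intro v; rw [mem_un, mem_un]; grind
  · have hwa := hr w hw
    have haw := hsymm _ _ hwa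
    by_cases ho : ∃ b, b ≠ w ∧ b ≠ f w ∧ f b = f w
    · obtain ⟨b, hb1, hb2, hb3⟩ := ho
      refine key (fun v => if v = u then w else if v = w then w else f v) ?_ ?_ ?_ ?_
      · intro v; grind
      · intro v; grind
      · rw [mem_un]; grind
      · intro v; rw [mem_un, mem_un]; grind
    · push Not at ho
      refine key (fun v => if v = u then w else if v = w then w else if v = f w then w else f v)
        ?_ ?_ ?_ ?_
      · intro v; grind
      · intro v; grind
      · rw [mem_un]; grind
      · intro v; rw [mem_un, mem_un]; grind

/-- valid star systems -/
def Valid {V : Type*} (G : SimpleGraph V) (L : V → Prop) (f : V → V) : Prop :=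
  (∀ v, f (f v) = f v) ∧ (∀ v, f v ≠ v → G.Adj v (f v)) ∧
  (∀ v w, f v = f w → f v ≠ v → f w ≠ w → ¬ G.Adj v w) ∧
  (∀ v w, f v = f w → f v ≠ v → f w ≠ w → L v → L w → v = w)

lemma exists_valid {V : Type*} [Fintype V] [DecidableEq V] (G : SimpleGraph V)
    [DecidableRel G.Adj] (L : V → Prop) [DecidablePred L] :
    ∃ f, Valid G L f ∧ (un f).card ≤
      Nat.card {c : G.ConnectedComponent // Odd (Nat.card c.supp)} + (univ.filter L).card := by
  classical
  obtain ⟨S, hS, hind, hcard⟩ := exists_S G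
  have hadj : ∀ x y, s(x, y) ∈ S → G.Adj x y := by
    intro x y h; simpa using hS h
  obtain ⟨f, hid, hr, hun⟩ := exists_f (fun x y => s(x, y) ∈ S)
    (fun x y h => by rw [Sym2.eq_swap]; exact h)
  have hunc : (un f).card ≤ (ev S).card := by
    apply Finset.card_le_card
    intro v hv
    rw [ev, Finset.mem_filter]
    refine ⟨Finset.mem_univ _, ?_⟩
    unfold par
    apply Finset.sum_eq_zero
    intro e he
    rw [if_neg]
    intro hve
    obtain ⟨w, rfl⟩ := hve
    exact hun v hv w (hadj _ _ he).ne' he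
  have hk : ∀ a, ∃ k, (∃ w, w ≠ a ∧ f w = a ∧ L w) → (k ≠ a ∧ f k = a ∧ L k) := by
    intro a
    by_cases h : ∃ w, w ≠ a ∧ f w = a ∧ L w
    · obtain ⟨w, hw⟩ := h; exact ⟨w, fun _ => hw⟩
    · exact ⟨a, fun h' => absurd h' h⟩
  choose k hk using hk
  refine ⟨fun v => if L v ∧ v ≠ k (f v) then v else f v, ⟨?_, ?_, ?_, ?_⟩, ?_⟩
  · intro v; grind
  · intro v hv
    have : ¬ (L v ∧ v ≠ k (f v)) := by
      intro h; simp [h] at hv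
    simp only [if_neg this] at hv ⊢
    exact hadj _ _ (hr v hv)
  · intro v w hvw hv hw
    have h1 : ¬ (L v ∧ v ≠ k (f v)) := by
      intro h; simp [h] at hv
    have h2 : ¬ (L w ∧ w ≠ k (f w)) := by
      intro h; simp [h] at hw
    simp only [if_neg h1, if_neg h2] at hv hw hvw
    have e1 := hr v hv
    have e2 := hr w hw
    rw [Sym2.eq_swap] at e1 e2
    rw [← hvw] at e2
    exact hind _ _ _ e1 e2
  · intro v w hvw hv hw lv lw; grind
  · have : un (fun v => if L v ∧ v ≠ k (f v) then v else f v) ⊆ un f ∪ univ.filter L := by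
      intro v hv
      simp only [Finset.mem_union, Finset.mem_filter, Finset.mem_univ, true_and]
      by_contra hcon
      push Not at hcon
      obtain ⟨h1, h2⟩ := hcon
      rw [mem_un] at h1 hv
      apply h1
      have hv0 : f v = v := by have := hv v; grind
      intro w
      constructor
      · intro hw
        by_contra hne
        by_cases hLw : L w
        · obtain ⟨k1, k2, k3⟩ := hk v ⟨w, hne, hw, hLw⟩
          have hkv := (hv (k v)).1 (by rw [if_neg (by rw [k2]; simp), k2])
          exact k1 hkv
        · exact hne ((hv w).1 (by rw [if_neg (fun h => hLw h.1), hw]))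
      · rintro rfl; exact hv0
    have h1 := Finset.card_le_card this
    have h2 := Finset.card_union_le (un f) (univ.filter L)
    omega

lemma exists_valid' {V : Type*} [Fintype V] [DecidableEq V] (G : SimpleGraph V)
    [DecidableRel G.Adj] (L : V → Prop) [DecidablePred L] :
    ∃ f, Valid G L f ∧ (∀ u ∈ un f, ∀ v ∈ un f, ¬ G.Adj u v) ∧ (un f).card ≤
      Nat.card {c : G.ConnectedComponent // Odd (Nat.card c.supp)} + (univ.filter L).card := by
  classical
  obtain ⟨f0, hf0, hc⟩ := exists_valid G L
  obtain ⟨f, hf, hmin⟩ := Finset.exists_min_image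
    ((univ : Finset (V → V)).filter (Valid G L))
    (fun f => (un f).card) ⟨f0, by simpa using hf0⟩
  simp only [Finset.mem_filter, Finset.mem_univ, true_and] at hf hmin
  refine ⟨f, hf, ?_, (hmin f0 hf0).trans hc⟩
  intro u hu v hv huv
  have hne := huv.ne
  have hlt : (un (fun x => if x = u then v else f x)).card < (un f).card := by
    apply Finset.card_lt_card
    have hu' := mem_un.1 hu
    have hv' := mem_un.1 hv
    rw [Finset.ssubset_iff_of_subset]
    · refine ⟨u, hu, ?_⟩
      rw [mem_un]
      intro h
      have := (h u).2 rfl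
      rw [if_pos rfl] at this
      exact hne this.symm
    · intro x; rw [mem_un, mem_un]; grind
  have hu := mem_un.1 hu
  have hv := mem_un.1 hv
  obtain ⟨h1, h2, h3, h4⟩ := hf
  have := hmin (fun x => if x = u then v else f x) ⟨by grind, by grind, by
    intro x y; have := hu x; have := hu y; have := hv x; have := hv y
    have := G.irrefl (v := u)
    grind, by
    intro x y; have := hu x; have := hu y; have := hv x; have := hv y; grind⟩
  omega

end StarAux

/-- Star-decomposition lemma: a graph with `n` vertices, `m ≤ Cn` edges, maximum
degree `Δ` and `τ` odd components admits a partition of its vertex set into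
induced stars `T₁, …, T_s` (each of size between 2 and `Δ+1`, all but at most
one non-apex vertex of each star having degree at most `2C/ε`) together with an
independent set `U` of size at most `τ + εn`. -/
theorem stmt11 {V : Type*} [Fintype V] [DecidableEq V]
    (G : SimpleGraph V) [DecidableRel G.Adj]
    (ε C : ℝ) (hε : 0 < ε) (hC : 0 < C)
    (n m : ℕ) (hn : n = Fintype.card V) (hm : m = G.edgeFinset.card)
    (hmC : (m : ℝ) ≤ C * n)
    (Δ : ℕ) (hΔ : Δ = G.maxDegree)
    (τ : ℕ)
    (hτ : τ = Nat.card {c : G.ConnectedComponent // Odd (Nat.card c.supp)}) :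
    ∃ (s : ℕ) (T : Fin s → Finset V) (U : Finset V),
      -- `T₁ ∪ ⋯ ∪ T_s ∪ U` is a partition of the vertex set
      (∀ i j, i ≠ j → Disjoint (T i) (T j)) ∧
      (∀ i, Disjoint (T i) U) ∧
      (Finset.univ.biUnion T ∪ U = Finset.univ) ∧
      -- (i) and (ii): each `T i` induces a star with an apex `a`
      (∀ i, ∃ a ∈ T i,
        2 ≤ (T i).card ∧ (T i).card ≤ Δ + 1 ∧
        (∀ u ∈ T i, ∀ v ∈ T i, G.Adj u v ↔ ((u = a ∨ v = a) ∧ u ≠ v)) ∧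
        -- all but at most one non-apex vertex has degree at most `2C/ε`
        (∃ u0, ∀ v ∈ T i, v ≠ a → v ≠ u0 → (G.degree v : ℝ) ≤ 2 * C / ε)) ∧
      -- (iii): `U` is independent and small
      (∀ u ∈ U, ∀ v ∈ U, ¬ G.Adj u v) ∧
      ((U.card : ℝ) ≤ (τ : ℝ) + ε * n) := by
  classical
  subst hn hm hΔ hτ
  obtain ⟨f, ⟨h1, h2, h3, h4⟩, hind, hcard⟩ :=
    StarAux.exists_valid' G (fun v => 2 * C / ε < (G.degree v : ℝ))
  set A : Finset V := univ.filter (fun a => f a = a ∧ a ∉ StarAux.un f) with hA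
  have hAmem : ∀ a, a ∈ A ↔ f a = a ∧ a ∉ StarAux.un f := by intro a; simp [hA]
  set e := A.equivFin with he
  refine ⟨A.card, fun i => univ.filter (fun v => f v = (e.symm i : V)), StarAux.un f,
    ?_, ?_, ?_, ?_, hind, ?_⟩
  · intro i j hij
    rw [Finset.disjoint_left]
    intro x hx hy
    simp only [Finset.mem_filter, Finset.mem_univ, true_and] at hx hy
    exact hij (e.symm.injective (Subtype.ext (hx.symm.trans hy)))
  · intro i
    rw [Finset.disjoint_left]
    intro x hx hy
    simp only [Finset.mem_filter, Finset.mem_univ, true_and] at hx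
    have h := (StarAux.mem_un.1 hy x).2 rfl
    have h' := (hAmem _).1 (e.symm i).2
    rw [← hx, h] at h'
    exact h'.2 hy
  · ext x
    simp only [Finset.mem_union, Finset.mem_biUnion, Finset.mem_filter, Finset.mem_univ, true_and,
      iff_true]
    by_cases hx : f x ∈ A
    · exact Or.inl ⟨e ⟨f x, hx⟩, by simp⟩
    · right
      rw [hAmem] at hx
      have hfx : f x ∈ StarAux.un f := by
        by_contra h; exact hx ⟨h1 x, h⟩
      have := (StarAux.mem_un.1 hfx x).1 rfl
      rw [this]; exact hfx
  · intro i
    have ha := (e.symm i).2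
    beta_reduce
    generalize ((e.symm i : A) : V) = a at ha ⊢
    have ha' := (hAmem a).1 ha
    obtain ⟨hfa, hau⟩ := ha'
    simp only [Finset.mem_filter, Finset.mem_univ, true_and]
    refine ⟨a, hfa, ?_, ?_, ?_, ?_⟩
    · rw [StarAux.mem_un] at hau
      have : ∃ w, w ≠ a ∧ f w = a := by grind
      obtain ⟨w, hw1, hw2⟩ := this
      have : ({w, a} : Finset V) ⊆ univ.filter (fun v => f v = a) := by
        intro x; simp only [Finset.mem_insert, Finset.mem_singleton, Finset.mem_filter,
          Finset.mem_univ, true_and]; grind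
      have := Finset.card_le_card this
      rwa [Finset.card_pair hw1] at this
    · have : univ.filter (fun v => f v = a) ⊆ insert a (G.neighborFinset a) := by
        intro x hx
        simp only [Finset.mem_filter, Finset.mem_univ, true_and] at hx
        rw [Finset.mem_insert, SimpleGraph.mem_neighborFinset]
        by_cases hxa : x = a
        · exact Or.inl hxa
        · right
          have := h2 x (by rw [hx]; exact Ne.symm hxa)
          rw [hx] at this
          exact this.symm
      have h5 := Finset.card_le_card this
      have h6 := Finset.card_insert_le a (G.neighborFinset a)
      have h7 := G.degree_le_maxDegree a
      rw [← SimpleGraph.card_neighborFinset_eq_degree] at h7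
      omega
    · intro u hu v hv
      constructor
      · intro h
        refine ⟨?_, h.ne⟩
        by_contra hcon
        push Not at hcon
        exact h3 u v (hu.trans hv.symm) (by rw [hu]; exact hcon.1.symm)
          (by rw [hv]; exact hcon.2.symm) h
      · rintro ⟨h | h, hne⟩
        · subst h
          have := h2 v (by rw [hv]; exact hne)
          rw [hv] at this; exact this.symm
        · subst h
          have := h2 u (by rw [hu]; exact hne.symm)
          rwa [hu] at this
    · by_cases hex : ∃ u0, f u0 = a ∧ u0 ≠ a ∧ 2 * C / ε < (G.degree u0 : ℝ)
      · obtain ⟨u0, hu1, hu2, hu3⟩ := hex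
        refine ⟨u0, fun v hv hva hv0 => ?_⟩
        by_contra hcon
        exact hv0 (h4 v u0 (hv.trans hu1.symm) (by rw [hv]; exact hva.symm)
          (by rw [hu1]; exact hu2.symm) (not_le.1 hcon) hu3)
      · push Not at hex
        exact ⟨a, fun v hv hva _ => hex v hv hva⟩
  · have hL : ((univ.filter (fun v => 2 * C / ε < (G.degree v : ℝ))).card : ℝ)
        ≤ ε * (Fintype.card V : ℝ) := by
      set L := univ.filter (fun v => 2 * C / ε < (G.degree v : ℝ)) with hLdef
      have hs : ∑ v, (G.degree v : ℝ) = 2 * (G.edgeFinset.card : ℝ) := by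
        exact_mod_cast G.sum_degrees_eq_twice_card_edges
      have hs1 : (L.card : ℝ) * (2 * C / ε) ≤ ∑ v ∈ L, (G.degree v : ℝ) := by
        rw [← nsmul_eq_mul]
        apply Finset.card_nsmul_le_sum
        intro v hv
        exact (Finset.mem_filter.1 hv).2.le
      have hs2 : ∑ v ∈ L, (G.degree v : ℝ) ≤ ∑ v, (G.degree v : ℝ) :=
        Finset.sum_le_sum_of_subset_of_nonneg (Finset.subset_univ _) (fun _ _ _ => by positivity)
      have hs3 : (L.card : ℝ) * (2 * C / ε) ≤ 2 * C * (Fintype.card V : ℝ) := by linarith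
      have hs4 : (L.card : ℝ) * (2 * C / ε) = (2 * C) * ((L.card : ℝ) / ε) := by ring
      rw [hs4] at hs3
      have := le_of_mul_le_mul_left hs3 (by positivity)
      rw [div_le_iff₀ hε] at this
      linarith
    have : ((StarAux.un f).card : ℝ) ≤
        (Nat.card {c : G.ConnectedComponent // Odd (Nat.card c.supp)} : ℝ) +
        ((univ.filter (fun v => 2 * C / ε < (G.degree v : ℝ))).card : ℝ) := by
      exact_mod_cast hcard
    linarith
end

section
/- Every undirected graph with n vertices, m edges, and τ odd components admits a bipartition V = V1 ∪ V2 with e(V1,V2) ≥ m/2 + (n−τ)/4. -/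
open Finset

namespace EdwardsAux

set_option linter.unusedSectionVars false

/-- Adjacency as an integer. -/
noncomputable def adjZ {V : Type*} (G : SimpleGraph V) (u v : V) : ℤ :=
  open Classical in if G.Adj u v then 1 else 0

theorem adjZ_symm {V : Type*} (G : SimpleGraph V) (u v : V) : adjZ G u v = adjZ G v u := by
  unfold adjZ
  by_cases h : G.Adj u v
  · rw [if_pos h, if_pos h.symm]
  · rw [if_neg h, if_neg fun h' => h h'.symm]

theorem adjZ_self {V : Type*} (G : SimpleGraph V) (u : V) : adjZ G u u = 0 := by
  simp [adjZ]

/-- Four times the excess of the cut given by the signs on the subgraph induced by `S`. -/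
noncomputable def Q {V : Type*} (G : SimpleGraph V) (S : Finset V) (s : V → ℤ) : ℤ :=
  -∑ u ∈ S, ∑ v ∈ S, adjZ G u v * (s u * s v)

/-- Sign vectors. -/
def IsSign {V : Type*} (s : V → ℤ) : Prop := ∀ v, s v = 1 ∨ s v = -1

/-- There is a cut of excess at least `x / 4`. -/
def Good {V : Type*} (G : SimpleGraph V) (S : Finset V) (x : ℤ) : Prop :=
  ∃ s : V → ℤ, IsSign s ∧ x ≤ Q G S s

variable {V : Type*} [DecidableEq V] (G : SimpleGraph V)

theorem Q_union {A B : Finset V} (h : Disjoint A B) (s : V → ℤ) :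
    Q G (A ∪ B) s = Q G A s + Q G B s - 2 * ∑ u ∈ A, ∑ v ∈ B, adjZ G u v * (s u * s v) := by
  have h1 : ∑ u ∈ B, ∑ v ∈ A, adjZ G u v * (s u * s v)
      = ∑ u ∈ A, ∑ v ∈ B, adjZ G u v * (s u * s v) := by
    rw [Finset.sum_comm]
    refine Finset.sum_congr rfl fun u _ => Finset.sum_congr rfl fun v _ => ?_
    rw [adjZ_symm G v u, mul_comm (s v)]
  simp only [Q, Finset.sum_union h, Finset.sum_add_distrib, h1]
  ring

theorem Q_congr {A : Finset V} {s t : V → ℤ} (h : ∀ u ∈ A, ∀ v ∈ A, s u * s v = t u * t v) :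
    Q G A s = Q G A t := by
  unfold Q
  congr 1
  refine Finset.sum_congr rfl fun u hu => Finset.sum_congr rfl fun v hv => ?_
  rw [h u hu v hv]

theorem Good.union {A B : Finset V} (h : Disjoint A B) {x y : ℤ}
    (hA : Good G A x) (hB : Good G B y) : Good G (A ∪ B) (x + y) := by
  obtain ⟨s, hs, hsx⟩ := hA
  obtain ⟨t, ht, hty⟩ := hB
  have hnot : ∀ v ∈ B, v ∉ A := fun v hv hv' => Finset.disjoint_left.mp h hv' hv
  have key : ∀ e : ℤ, (e = 1 ∨ e = -1) →
      IsSign (fun v => if v ∈ A then s v else e * t v) ∧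
      Q G (A ∪ B) (fun v => if v ∈ A then s v else e * t v) =
        Q G A s + Q G B t - e * (2 * ∑ u ∈ A, ∑ v ∈ B, adjZ G u v * (s u * t v)) := by
    intro e he
    constructor
    · intro v
      have := hs v
      have := ht v
      dsimp only
      split_ifs
      · exact hs v
      · rcases he with rfl | rfl <;> omega
    · rw [Q_union G h]
      congr 1
      · congr 1
        · apply Q_congr
          intro u hu v hv
          simp [hu, hv]
        · apply Q_congr
          intro u hu v hv
          simp only [hnot u hu, hnot v hv, if_false]
          rcases he with rfl | rfl <;> ring
      · rw [mul_left_comm]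
        congr 1
        rw [Finset.mul_sum]
        refine Finset.sum_congr rfl fun u hu => ?_
        rw [Finset.mul_sum]
        refine Finset.sum_congr rfl fun v hv => ?_
        simp only [hu, hnot v hv, if_true, if_false]
        ring
  obtain ⟨a1, a2⟩ := key 1 (Or.inl rfl)
  obtain ⟨b1, b2⟩ := key (-1) (Or.inr rfl)
  rcases le_total (2 * ∑ u ∈ A, ∑ v ∈ B, adjZ G u v * (s u * t v)) 0 with h0 | h0
  · exact ⟨_, a1, by rw [a2]; linarith⟩
  · exact ⟨_, b1, by rw [b2]; linarith⟩

theorem Good.empty : Good G ∅ 0 := ⟨fun _ => 1, fun _ => Or.inl rfl, by simp [Q]⟩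

theorem Good.single (v : V) : Good G {v} 0 :=
  ⟨fun _ => 1, fun _ => Or.inl rfl, by simp [Q, adjZ_self]⟩

theorem Q_single (v : V) (s : V → ℤ) : Q G {v} s = 0 := by simp [Q, adjZ_self]

theorem Q_even (S : Finset V) (s : V → ℤ) : Even (Q G S s) := by
  induction S using Finset.induction_on with
  | empty => simp [Q]
  | insert a S ha ih =>
    rw [Finset.insert_eq, Q_union G (by simpa using ha), Q_single, zero_add]
    exact ih.sub (even_two_mul _)

theorem star {r : V} {L : Finset V} (hL : L.Nonempty) (hr : ∀ v ∈ L, G.Adj r v)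
    (hind : ∀ u ∈ L, ∀ v ∈ L, ¬ G.Adj u v) : Good G ({r} ∪ L) (L.card + 1) := by
  have hrL : r ∉ L := fun h => G.loopless.irrefl r (hr r h)
  refine ⟨fun v => if v = r then 1 else -1, fun v => by dsimp only; split_ifs <;> simp, ?_⟩
  rw [Q_union G (by simpa using hrL), Q_single]
  have h1 : Q G L (fun v => if v = r then 1 else -1) = 0 := by
    unfold Q
    rw [neg_eq_zero]
    refine Finset.sum_eq_zero fun u hu => Finset.sum_eq_zero fun v hv => ?_
    simp [adjZ, hind u hu v hv]
  have h2 : ∑ v ∈ L, adjZ G r v * ((if r = r then (1:ℤ) else -1) * (if v = r then 1 else -1))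
      = ∑ v ∈ L, (-1 : ℤ) := by
    refine Finset.sum_congr rfl fun v hv => ?_
    have : v ≠ r := fun h => hrL (h ▸ hv)
    simp [adjZ, hr v hv, this]
  rw [h1, Finset.sum_singleton, h2]
  have := hL.card_pos
  simp
  omega

theorem dfs (N : ℕ) : ∀ (S : Finset V) (r : V), S.card ≤ N → r ∉ S →
    ∃ A ⊆ S, ∃ L ⊆ A, (∀ u ∈ A, G.Reachable r u) ∧
      (∀ u ∈ insert r A, ∀ v ∈ S, v ∉ A → ¬ G.Adj u v) ∧
      (∀ v ∈ L, G.Adj r v) ∧ (∀ u ∈ L, ∀ v ∈ L, ¬ G.Adj u v) ∧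
      Good G (A \ L) ((A \ L).card) := by
  induction N with
  | zero =>
    intro S r hS _
    have : S = ∅ := by simpa using hS
    subst this
    exact ⟨∅, by simp, ∅, by simp, by simp, by simp, by simp, by simp,
      by simpa using Good.empty G⟩
  | succ N ih =>
    intro S r hS hrS
    by_cases hn : ∃ s ∈ S, G.Adj r s
    · obtain ⟨s, hsS, hrs⟩ := hn
      obtain ⟨A1, hA1, L1, hL1, reach1, cl1, adj1, ind1, good1⟩ := ih (S.erase s) s
        (by rw [Finset.card_erase_of_mem hsS]; omega) (by simp)
      have hsA1 : s ∉ A1 := fun h => by simpa using hA1 h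
      have hA1S : A1 ⊆ S := hA1.trans (Finset.erase_subset _ _)
      obtain ⟨A2, hA2, L2, hL2, reach2, cl2, adj2, ind2, good2⟩ := ih (S.erase s \ A1) r
        ((Finset.card_le_card Finset.sdiff_subset).trans
          (by rw [Finset.card_erase_of_mem hsS]; omega))
        (fun h => hrS (Finset.mem_of_mem_erase (Finset.mem_sdiff.mp h).1))
      have hA2' : ∀ v ∈ A2, v ∈ S ∧ v ≠ s ∧ v ∉ A1 := fun v hv => by
        have := hA2 hv
        simp only [Finset.mem_sdiff, Finset.mem_erase] at this
        tauto
      have hsA2 : s ∉ A2 := fun h => (hA2' s h).2.1 rfl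
      have hd12 : Disjoint A1 A2 := Finset.disjoint_right.mpr fun v hv => (hA2' v hv).2.2
      have hsub : insert s A1 ∪ A2 ⊆ S := by
        intro v hv
        simp only [Finset.mem_union, Finset.mem_insert] at hv
        rcases hv with (rfl | h) | h
        · exact hsS
        · exact hA1S h
        · exact (hA2' v h).1
      have hreach : ∀ u ∈ insert s A1 ∪ A2, G.Reachable r u := by
        intro v hv
        simp only [Finset.mem_union, Finset.mem_insert] at hv
        rcases hv with (rfl | h) | h
        · exact hrs.reachable
        · exact hrs.reachable.trans (reach1 v h)
        · exact reach2 v h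
      have hcl : ∀ u ∈ insert r (insert s A1 ∪ A2), ∀ v ∈ S, v ∉ insert s A1 ∪ A2 →
          ¬ G.Adj u v := by
        intro u hu v hv hv'
        simp only [Finset.mem_union, Finset.mem_insert, not_or] at hu hv'
        obtain ⟨⟨h1, h2⟩, h3⟩ := hv'
        have hve : v ∈ S.erase s := Finset.mem_erase.mpr ⟨h1, hv⟩
        have hvd : v ∈ S.erase s \ A1 := Finset.mem_sdiff.mpr ⟨hve, h2⟩
        rcases hu with rfl | (rfl | h) | h
        · exact cl2 _ (by simp) v hvd h3
        · exact cl1 _ (by simp) v hve h2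
        · exact cl1 u (by simp [h]) v hve h2
        · exact cl2 u (by simp [h]) v hvd h3
      rcases L1.eq_empty_or_nonempty with hL | hL
      · subst hL
        refine ⟨insert s A1 ∪ A2, hsub, insert s L2, ?_, hreach, hcl, ?_, ?_, ?_⟩
        · intro v hv
          simp only [Finset.mem_union, Finset.mem_insert] at hv ⊢
          rcases hv with h | h
          · exact Or.inl (Or.inl h)
          · exact Or.inr (hL2 h)
        · intro v hv
          rcases Finset.mem_insert.mp hv with rfl | h
          · exact hrs
          · exact adj2 v h
        · have hs2 : ∀ v ∈ L2, ¬ G.Adj s v := fun v hv => by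
            have := hA2' v (hL2 hv)
            exact cl1 s (by simp) v (Finset.mem_erase.mpr ⟨this.2.1, this.1⟩) this.2.2
          intro u hu v hv
          rcases Finset.mem_insert.mp hu with h1 | h1 <;>
          rcases Finset.mem_insert.mp hv with h2 | h2
          · rw [h1, h2]
            exact G.loopless.irrefl _
          · rw [h1]
            exact hs2 v h2
          · rw [h2]
            exact fun h => hs2 u h1 h.symm
          · exact ind2 u h1 v h2
        · have e : (insert s A1 ∪ A2) \ insert s L2 = (A1 \ ∅) ∪ (A2 \ L2) := by
            ext v
            have h1 := hA2' v
            have h2 := @hL2 v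
            simp only [Finset.mem_union, Finset.mem_insert, Finset.mem_sdiff,
              Finset.notMem_empty]
            by_cases hvs : v = s
            · subst hvs; tauto
            · tauto
          have hd : Disjoint (A1 \ ∅) (A2 \ L2) :=
            hd12.mono Finset.sdiff_subset Finset.sdiff_subset
          rw [e, Finset.card_union_of_disjoint hd]
          push_cast
          exact good1.union G hd good2
      · refine ⟨insert s A1 ∪ A2, hsub, L2, ?_, hreach, hcl, adj2, ind2, ?_⟩
        · exact hL2.trans Finset.subset_union_right
        · have hst := star G hL adj1 ind1
          have e : (insert s A1 ∪ A2) \ L2 = (({s} ∪ L1) ∪ (A1 \ L1)) ∪ (A2 \ L2) := by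
            ext v
            have h1 := hA2' v
            have h2 := @hL2 v
            have h3 := @hL1 v
            simp only [Finset.mem_union, Finset.mem_insert, Finset.mem_sdiff,
              Finset.mem_singleton]
            by_cases hvs : v = s
            · subst hvs; tauto
            · tauto
          have hd0 : Disjoint ({s} : Finset V) L1 := by
            simpa using fun h => hsA1 (hL1 h)
          have hd1 : Disjoint ({s} ∪ L1) (A1 \ L1) := by
            rw [Finset.disjoint_union_left]
            refine ⟨by simp [hsA1], Finset.disjoint_sdiff⟩
          have hd : Disjoint (({s} ∪ L1) ∪ (A1 \ L1)) (A2 \ L2) := by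
            refine Finset.disjoint_left.mpr fun v hv hv2 => ?_
            have h1 := hA2' v (Finset.mem_sdiff.mp hv2).1
            have h3 := @hL1 v
            simp only [Finset.mem_union, Finset.mem_sdiff, Finset.mem_singleton] at hv
            tauto
          have := (hst.union G hd1 good1).union G hd good2
          rw [e, Finset.card_union_of_disjoint hd, Finset.card_union_of_disjoint hd1,
            Finset.card_union_of_disjoint hd0, Finset.card_singleton]
          convert this using 1
          push_cast
          ring
    · push Not at hn
      exact ⟨∅, by simp, ∅, by simp, by simp, by simpa using hn, by simp, by simp,
        by simpa using Good.empty G⟩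

theorem Good.mono {S : Finset V} {x y : ℤ} (h : Good G S x) (hxy : y ≤ x) : Good G S y := by
  obtain ⟨s, hs, h⟩ := h
  exact ⟨s, hs, hxy.trans h⟩

theorem component [Fintype V] (c : G.ConnectedComponent) (C : Finset V)
    (hC : ∀ v, v ∈ C ↔ G.connectedComponentMk v = c) :
    Good G C (C.card - if Odd C.card then 1 else 0) := by
  obtain ⟨r, rfl⟩ := c.exists_rep
  obtain ⟨A, hA, L, hL, reach, cl, adj, ind, good⟩ :=
    dfs G _ (Finset.univ.erase r) r le_rfl (by simp)
  have hrA : r ∉ A := fun h => by simpa using hA h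
  have closed : ∀ u v, G.Adj u v → u ∈ insert r A → v ∈ insert r A := by
    intro u v huv hu
    by_contra hv
    simp only [Finset.mem_insert, not_or] at hv
    exact cl u hu v (by simp [hv.1]) hv.2 huv
  have e : C = insert r A := by
    ext v
    rw [hC]
    constructor
    · intro h
      have hr : G.Reachable r v := (SimpleGraph.ConnectedComponent.exact h).symm
      obtain ⟨w⟩ := hr
      have : ∀ {a b : V} (w : G.Walk a b), a ∈ insert r A → b ∈ insert r A := by
        intro a b w
        induction w with
        | nil => exact id
        | cons h _ ih => exact fun ha => ih (closed _ _ h ha)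
      exact this w (by simp)
    · intro h
      rcases Finset.mem_insert.mp h with rfl | h
      · rfl
      · exact SimpleGraph.ConnectedComponent.sound (reach v h).symm
  have hg : Good G C (C.card - 1) := by
    have hd0 : Disjoint ({r} : Finset V) L := by simpa using fun h => hrA (hL h)
    have hd1 : Disjoint ({r} ∪ L) (A \ L) := by
      rw [Finset.disjoint_union_left]
      exact ⟨by simp [hrA], Finset.disjoint_sdiff⟩
    have e2 : C = ({r} ∪ L) ∪ (A \ L) := by
      rw [e, Finset.union_assoc, Finset.union_sdiff_of_subset hL, Finset.insert_eq]
    rw [e2, Finset.card_union_of_disjoint hd1, Finset.card_union_of_disjoint hd0,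
      Finset.card_singleton]
    rcases L.eq_empty_or_nonempty with h | h
    · subst h
      refine Good.mono G ((Good.single G r).union G (by simpa using hd1) good) ?_
      simp
    · refine Good.mono G ((star G h adj ind).union G hd1 good) ?_
      push_cast
      linarith
  split_ifs with ho
  · exact hg
  · obtain ⟨s, hs, h⟩ := hg
    refine ⟨s, hs, ?_⟩
    have h1 := Q_even G C s
    rw [Nat.not_odd_iff_even] at ho
    obtain ⟨a, ha⟩ := h1
    obtain ⟨b, hb⟩ := ho
    omega

theorem all [Fintype V] (τ : ℕ)
    (hτ : τ = Nat.card {c : G.ConnectedComponent // Odd (Nat.card c.supp)}) :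
    Good G Finset.univ ((Fintype.card V : ℤ) - τ) := by
  classical
  let C : G.ConnectedComponent → Finset V := fun c =>
    Finset.univ.filter fun v => G.connectedComponentMk v = c
  have hdisj : ∀ c d, c ≠ d → Disjoint (C c) (C d) := by
    intro c d hcd
    refine Finset.disjoint_left.mpr fun v h1 h2 => hcd ?_
    simp only [C, Finset.mem_filter, Finset.mem_univ, true_and] at h1 h2
    rw [← h1, ← h2]
  have key : ∀ T : Finset G.ConnectedComponent, Good G (T.biUnion C)
      (∑ c ∈ T, (((C c).card : ℤ) - if Odd (C c).card then 1 else 0)) := by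
    intro T
    induction T using Finset.induction_on with
    | empty => simpa using Good.empty G
    | insert a T ha ih =>
      rw [Finset.biUnion_insert, Finset.sum_insert ha]
      refine Good.union G ?_ (component G a (C a) (by simp [C])) ih
      rw [Finset.disjoint_biUnion_right]
      exact fun d hd => hdisj a d fun h => ha (h ▸ hd)
  have h := key Finset.univ
  have e1 : (Finset.univ : Finset G.ConnectedComponent).biUnion C = Finset.univ := by
    ext v
    simp [C]
  have e2 : ∑ c, ((C c).card : ℤ) = Fintype.card V := by
    rw [← Finset.card_univ, ← e1, Finset.card_biUnion fun c _ d _ h => hdisj c d h]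
    push_cast
    rfl
  have e3 : ∀ c : G.ConnectedComponent, Nat.card c.supp = (C c).card := by
    intro c
    rw [Nat.card_eq_fintype_card, Fintype.card_subtype]
    congr 1
    ext v
    simp [C, SimpleGraph.ConnectedComponent.mem_supp_iff]
  have e4 : (∑ c, if Odd (C c).card then (1 : ℤ) else 0) = τ := by
    rw [hτ, Nat.card_eq_fintype_card, Fintype.card_subtype, Finset.sum_boole]
    simp only [e3]
  rw [Finset.sum_sub_distrib, e2, e4, e1] at h
  exact h

end EdwardsAux

/-- Every graph with `n` vertices, `m` edges, and `τ` odd components admits a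
bipartition `V = V₁ ∪ V₂` with `e(V₁,V₂) ≥ m/2 + (n−τ)/4`. -/
theorem stmt17 {V : Type*} [Fintype V] [DecidableEq V]
    (G : SimpleGraph V) [DecidableRel G.Adj]
    (n m : ℕ) (hn : n = Fintype.card V) (hm : m = G.edgeFinset.card)
    (τ : ℕ)
    (hτ : τ = Nat.card {c : G.ConnectedComponent // Odd (Nat.card c.supp)}) :
    ∃ V1 : Finset V,
      ((((V1 ×ˢ V1ᶜ).filter fun p => G.Adj p.1 p.2).card : ℝ)
        ≥ (m : ℝ) / 2 + ((n : ℝ) - τ) / 4) := by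
  obtain ⟨s, hs, h⟩ := EdwardsAux.all G τ hτ
  refine ⟨Finset.univ.filter fun v => s v = 1, ?_⟩
  set V1 : Finset V := Finset.univ.filter fun v => s v = 1 with hV1
  let p : V → ℤ := fun v => if s v = 1 then 1 else 0
  have hsp : ∀ v, s v = 2 * p v - 1 := by
    intro v
    rcases hs v with h | h <;> simp [p, h]
  have hadj : ∀ u v, EdwardsAux.adjZ G u v = if G.Adj u v then 1 else 0 := by
    intro u v
    unfold EdwardsAux.adjZ
    congr
  have hcut : (((V1 ×ˢ V1ᶜ).filter fun p => G.Adj p.1 p.2).card : ℤ)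
      = ∑ u, ∑ v, EdwardsAux.adjZ G u v * (p u * (1 - p v)) := by
    rw [← Finset.sum_product', Finset.univ_product_univ, Finset.card_eq_sum_ones]
    push_cast
    rw [Finset.sum_filter, ← Finset.sum_subset (Finset.subset_univ (V1 ×ˢ V1ᶜ))]
    · refine Finset.sum_congr rfl fun x hx => ?_
      simp only [V1, Finset.mem_product, Finset.mem_compl, Finset.mem_filter,
        Finset.mem_univ, true_and] at hx
      simp [hadj, p, hx.1, hx.2]
    · intro x _ hx
      simp only [V1, Finset.mem_product, Finset.mem_compl, Finset.mem_filter,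
        Finset.mem_univ, true_and, not_and, not_not] at hx
      by_cases h1 : s x.1 = 1
      · simp [p, hx h1]
      · simp [p, h1]
  have hcut2 : ∑ u, ∑ v, EdwardsAux.adjZ G u v * (p v * (1 - p u))
      = ∑ u, ∑ v, EdwardsAux.adjZ G u v * (p u * (1 - p v)) := by
    rw [Finset.sum_comm]
    refine Finset.sum_congr rfl fun u _ => Finset.sum_congr rfl fun v _ => ?_
    rw [EdwardsAux.adjZ_symm]
  have hdeg : ∑ u, ∑ v, EdwardsAux.adjZ G u v = 2 * (m : ℤ) := by
    have h1 := G.sum_degrees_eq_twice_card_edges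
    rw [hm]
    have h2 : ∀ u, ∑ v, EdwardsAux.adjZ G u v = (G.degree u : ℤ) := by
      intro u
      simp only [hadj, Finset.sum_boole]
      rw [← SimpleGraph.card_neighborFinset_eq_degree, SimpleGraph.neighborFinset_eq_filter]
    simp only [h2]
    exact_mod_cast h1
  have hQ : EdwardsAux.Q G Finset.univ s =
      4 * (((V1 ×ˢ V1ᶜ).filter fun p => G.Adj p.1 p.2).card : ℤ) - 2 * m := by
    have : EdwardsAux.Q G Finset.univ s =
        2 * ∑ u, ∑ v, EdwardsAux.adjZ G u v * (p u * (1 - p v))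
        + 2 * ∑ u, ∑ v, EdwardsAux.adjZ G u v * (p v * (1 - p u))
        - ∑ u, ∑ v, EdwardsAux.adjZ G u v := by
      unfold EdwardsAux.Q
      simp only [Finset.mul_sum, ← Finset.sum_neg_distrib, ← Finset.sum_add_distrib,
        ← Finset.sum_sub_distrib]
      refine Finset.sum_congr rfl fun u _ => Finset.sum_congr rfl fun v _ => ?_
      rw [hsp u, hsp v]
      ring
    rw [this, hcut2, hdeg, ← hcut]
    ring
  rw [hQ, ← hn] at h
  have h' : (n : ℝ) - τ ≤
      4 * (((V1 ×ˢ V1ᶜ).filter fun p => G.Adj p.1 p.2).card : ℝ) - 2 * m := by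
    exact_mod_cast h
  linarith
end

section
/- Every directed graph with m edges and minimum outdegree at least 2 admits, for every ε > 0 and m sufficiently large, a bipartition V = V1 ∪ V2 of its vertex set with min{e(V1,V2), e(V2,V1)} ≥ (1/6 − ε)m. -/
open Finset

/-- The number of directed edges from `X` to `Y`. -/
def eCount {V : Type} [DecidableEq V] (E : V → V → Prop) [DecidableRel E]
    (X Y : Finset V) : ℕ :=
  ((X ×ˢ Y).filter fun p => E p.1 p.2).card

/-- Outdegree of `v`. -/
def outDeg {V : Type} [Fintype V] (E : V → V → Prop) [DecidableRel E] (v : V) : ℕ :=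
  (Finset.univ.filter fun w => E v w).card


/-- A partition of the vertices into induced stars, given by the map to the centers. -/
def StarMap {V : Type} (H : V → V → Prop) (r : V → V) : Prop :=
  (∀ v, r v = v ∨ H v (r v)) ∧ (∀ v, r (r v) = r v) ∧
    ∀ v w, r v = r w → r v ≠ v → r w ≠ w → ¬ H v w

open Classical in
theorem exists_starMap {V : Type} [Fintype V] (H : V → V → Prop)
    (hs : ∀ u v, H u v → H v u) (hi : ∀ u, ¬ H u u) :
    ∃ r : V → V, StarMap H r ∧
      (univ.filter fun v => ∃ w, H v w).card ≤ 3 * (univ.filter fun v => r v ≠ v).card := by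
  obtain ⟨r, hr, hmax⟩ := Finset.exists_max_image (univ.filter fun r : V → V => StarMap H r)
    (fun r => (univ.filter fun v => r v ≠ v).card)
    ⟨id, mem_filter.2 ⟨mem_univ _, by simp [StarMap]⟩⟩
  have hr' : StarMap H r := by simpa using hr
  have hmax' : ∀ r', StarMap H r' → (univ.filter fun v => r' v ≠ v).card ≤
      (univ.filter fun v => r v ≠ v).card := fun r' h => hmax r' (by simpa using h)
  obtain ⟨h1, h2, h3⟩ := id hr'
  refine ⟨r, hr', ?_⟩
  let T : V → Prop := fun u => r u = u ∧ ∀ v, r v = u → v = u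
  have hb : ∀ u x, T u → r x = x → H u x → ∃ y, r y = x ∧ y ≠ x ∧ H u y := by
    intro u x hu hx hux
    by_contra! hcon
    have hne : u ≠ x := by rintro rfl; exact hi _ hux
    have hst : StarMap H (Function.update r u x) := by
      refine ⟨?_, ?_, ?_⟩
      · intro v
        by_cases hv : v = u
        · subst hv; right; simpa using hux
        · simpa [Function.update_of_ne hv] using h1 v
      · intro v
        by_cases hv : v = u
        · subst hv; simp [Function.update_of_ne hne.symm, hx]
        · have : r v ≠ u := fun h => hv (hu.2 v h)
          simp [Function.update_of_ne hv, Function.update_of_ne this, h2]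
      · intro v w hvw hv hw
        by_cases hvu : v = u
        · by_cases hwu : w = u
          · subst hvu; subst hwu; exact hi _
          · subst hvu
            simp only [Function.update_self, Function.update_of_ne hwu] at hvw hw
            exact hcon w hvw.symm (by rw [hvw]; exact fun h => hw h.symm)
        · by_cases hwu : w = u
          · subst hwu
            simp only [Function.update_self, Function.update_of_ne hvu] at hvw hv
            intro h
            exact hcon v hvw (by rw [← hvw]; exact fun h => hv h.symm) (hs _ _ h)
          · simp only [Function.update_of_ne hwu, Function.update_of_ne hvu] at hvw hv hw
            exact h3 v w hvw hv hw
    have := hmax' _ hst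
    have hlt : (univ.filter fun v => r v ≠ v) ⊂
        (univ.filter fun v => Function.update r u x v ≠ v) := by
      rw [Finset.ssubset_iff_of_subset]
      · exact ⟨u, by simp [hne.symm], by simp [hu.1]⟩
      · intro v hv
        have hv' : r v ≠ v := by simpa using hv
        have : v ≠ u := by rintro rfl; exact hv' hu.1
        simpa [Function.update_of_ne this] using hv'
    exact absurd (card_lt_card hlt) (by omega)
  have hTT : ∀ u w, T u → T w → ¬ H u w := by
    intro u w hu hw huw
    obtain ⟨y, hy, hne, -⟩ := hb u w hu hw.1 huw
    exact hne (hw.2 y hy)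
  have hc : ∀ u₁ u₂ y, T u₁ → T u₂ → r y ≠ y → H u₁ y → H u₂ y → u₁ = u₂ := by
    intro u₁ u₂ y hu₁ hu₂ hy hy₁ hy₂
    by_contra hne
    have hyu₁ : y ≠ u₁ := by rintro rfl; exact hy hu₁.1
    have hyu₂ : y ≠ u₂ := by rintro rfl; exact hy hu₂.1
    let r' : V → V := fun v => if v = u₁ ∨ v = u₂ ∨ v = y then y else r v
    have hry : ∀ v, r v ≠ y := fun v h => hy (by rw [← h, h2])
    have e1 : ∀ v, (v = u₁ ∨ v = u₂ ∨ v = y) → r' v = y := fun v h => if_pos h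
    have e2 : ∀ v, ¬ (v = u₁ ∨ v = u₂ ∨ v = y) → r' v = r v := fun v h => if_neg h
    have hst : StarMap H r' := by
      refine ⟨?_, ?_, ?_⟩
      · intro v
        by_cases hv : v = u₁ ∨ v = u₂ ∨ v = y
        · rw [e1 v hv]
          rcases hv with rfl | rfl | rfl
          · exact Or.inr hy₁
          · exact Or.inr hy₂
          · exact Or.inl rfl
        · rw [e2 v hv]; exact h1 v
      · intro v
        by_cases hv : v = u₁ ∨ v = u₂ ∨ v = y
        · rw [e1 v hv]; exact e1 y (by simp)
        · rw [e2 v hv, e2 (r v), h2]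
          rintro (h | h | h)
          · exact hv (Or.inl (hu₁.2 v h))
          · exact hv (Or.inr (Or.inl (hu₂.2 v h)))
          · exact hry v h
      · intro v w hvw hv hw
        by_cases hv' : v = u₁ ∨ v = u₂ ∨ v = y
        · by_cases hw' : w = u₁ ∨ w = u₂ ∨ w = y
          · rw [e1 v hv'] at hv
            rw [e1 w hw'] at hw
            have hTv : T v := by
              rcases hv' with rfl | rfl | rfl
              · exact hu₁
              · exact hu₂
              · exact absurd rfl hv
            have hTw : T w := by
              rcases hw' with rfl | rfl | rfl
              · exact hu₁
              · exact hu₂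
              · exact absurd rfl hw
            exact hTT _ _ hTv hTw
          · rw [e1 v hv', e2 w hw'] at hvw
            exact absurd hvw.symm (hry w)
        · by_cases hw' : w = u₁ ∨ w = u₂ ∨ w = y
          · rw [e2 v hv', e1 w hw'] at hvw
            exact absurd hvw (hry v)
          · rw [e2 v hv', e2 w hw'] at hvw
            rw [e2 v hv'] at hv
            rw [e2 w hw'] at hw
            exact h3 v w hvw hv hw
    have hle := hmax' _ hst
    have hsub : insert u₁ (insert u₂ ((univ.filter fun v => r v ≠ v).erase y)) ⊆
        univ.filter fun v => r' v ≠ v := by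
      intro v hv
      simp only [mem_insert, mem_erase, mem_filter, mem_univ, true_and] at hv ⊢
      rcases hv with rfl | rfl | ⟨hvy, hv⟩
      · rw [e1 v (by simp)]; exact hyu₁
      · rw [e1 v (by simp)]; exact hyu₂
      · rw [e2 v]
        · exact hv
        · rintro (rfl | rfl | rfl)
          · exact hv hu₁.1
          · exact hv hu₂.1
          · exact hvy rfl
    have hcard := card_le_card hsub
    rw [card_insert_of_notMem (by simp [hne, hu₁.1]), card_insert_of_notMem (by simp [hu₂.1]),
      card_erase_of_mem (by simpa using hy)] at hcard
    have : 0 < (univ.filter fun v => r v ≠ v).card := card_pos.2 ⟨y, by simpa using hy⟩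
    omega
  set L := univ.filter fun v => r v ≠ v with hL
  have hTL : ∀ u, T u → (∃ w, H u w) → ∃ y, r y ≠ y ∧ H u y := by
    rintro u hu ⟨w, hw⟩
    by_cases hww : r w = w
    · obtain ⟨y, hy, hne, hy'⟩ := hb u w hu hww hw
      exact ⟨y, by rw [hy]; exact hne.symm, hy'⟩
    · exact ⟨w, hww, hw⟩
  have hcT : (univ.filter fun u => T u ∧ ∃ w, H u w).card ≤ L.card := by
    choose! φ hφ using hTL
    apply card_le_card_of_injOn φ
    · intro u hu
      have hu' : T u ∧ ∃ w, H u w := by simpa using hu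
      simpa [hL] using (hφ u hu'.1 hu'.2).1
    · intro u hu v hv huv
      have hu' : T u ∧ ∃ w, H u w := by simpa using hu
      have hv' : T v ∧ ∃ w, H v w := by simpa using hv
      refine hc u v (φ u) hu'.1 hv'.1 (hφ u hu'.1 hu'.2).1 (hφ u hu'.1 hu'.2).2 ?_
      rw [huv]; exact (hφ v hv'.1 hv'.2).2
  have hsub : (univ.filter fun v => ∃ w, H v w) ⊆
      (univ.filter fun u => T u ∧ ∃ w, H u w) ∪ L ∪ L.image r := by
    intro v hv
    have hv' : ∃ w, H v w := by simpa using hv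
    by_cases h : r v = v
    · by_cases hT : T v
      · simp [hT, hv']
      · have : ∃ w, r w = v ∧ w ≠ v := by
          by_contra! hcon
          exact hT ⟨h, hcon⟩
        obtain ⟨w, hw, hwv⟩ := this
        apply mem_union_right
        exact mem_image.2 ⟨w, by simp [hL, hw, hwv.symm], hw⟩
    · apply mem_union_left; apply mem_union_right; simp [hL, h]
  have hcle := card_le_card hsub
  have h5 := card_union_le ((univ.filter fun u => T u ∧ ∃ w, H u w) ∪ L) (L.image r)
  have h6 := card_union_le (univ.filter fun u => T u ∧ ∃ w, H u w) L
  have h7 : (L.image r).card ≤ L.card := card_image_le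
  omega

/-- The sign of a boolean. -/
def sg (b : Bool) : ℝ := if b then 1 else -1

theorem sg_mul_self (b : Bool) : sg b * sg b = 1 := by cases b <;> simp [sg]
theorem sg_not (b : Bool) : sg (!b) = - sg b := by cases b <;> simp [sg]
theorem sg_or (b : Bool) : sg b = 1 ∨ sg b = -1 := by cases b <;> simp [sg]

/-- Average over all boolean assignments. -/
noncomputable def Ex {V : Type} [Fintype V] [DecidableEq V] (F : (V → Bool) → ℝ) : ℝ :=
  (∑ τ, F τ) / (Fintype.card (V → Bool) : ℝ)

section
variable {V : Type} [Fintype V] [DecidableEq V]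

theorem Ex_add (F G : (V → Bool) → ℝ) : Ex (fun τ => F τ + G τ) = Ex F + Ex G := by
  simp [Ex, Finset.sum_add_distrib, add_div]

theorem Ex_sub (F G : (V → Bool) → ℝ) : Ex (fun τ => F τ - G τ) = Ex F - Ex G := by
  simp [Ex, Finset.sum_sub_distrib, sub_div]

theorem Ex_mul (c : ℝ) (F : (V → Bool) → ℝ) : Ex (fun τ => c * F τ) = c * Ex F := by
  simp [Ex, ← Finset.mul_sum, mul_div_assoc]

theorem Ex_const (c : ℝ) : Ex (fun _ : V → Bool => c) = c := by
  have : (Fintype.card (V → Bool) : ℝ) ≠ 0 := by exact_mod_cast Fintype.card_ne_zero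
  simp only [Ex, Finset.sum_const, Finset.card_univ, nsmul_eq_mul]
  field_simp

theorem Ex_sum {ι : Type} (s : Finset ι) (F : ι → (V → Bool) → ℝ) :
    Ex (fun τ => ∑ i ∈ s, F i τ) = ∑ i ∈ s, Ex (F i) := by
  simp only [Ex]
  rw [Finset.sum_comm, Finset.sum_div]

theorem Ex_exists (F : (V → Bool) → ℝ) : ∃ τ, Ex F ≤ F τ := by
  by_contra! h
  have hlt : ∑ τ, F τ < ∑ _τ : V → Bool, Ex F :=
    Finset.sum_lt_sum_of_nonempty ⟨fun _ => true, mem_univ _⟩ (fun τ _ => h τ)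
  have hp : (0 : ℝ) < (Fintype.card (V → Bool) : ℝ) := by exact_mod_cast Fintype.card_pos
  simp only [Finset.sum_const, Finset.card_univ, nsmul_eq_mul] at hlt
  rw [Ex, mul_div_cancel₀ _ hp.ne'] at hlt
  exact lt_irrefl _ hlt

/-- Flip one coordinate. -/
def flipAt (i : V) (τ : V → Bool) : V → Bool := Function.update τ i (!τ i)

set_option linter.unusedSectionVars false in
theorem flipAt_invol (i : V) : Function.Involutive (flipAt i) := by
  intro τ
  simp [flipAt]

theorem Ex_odd (i : V) (F : (V → Bool) → ℝ) (h : ∀ τ, F (flipAt i τ) = - F τ) : Ex F = 0 := by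
  have h1 : ∑ τ, F (flipAt i τ) = ∑ τ, F τ :=
    Equiv.sum_comp (Function.Involutive.toPerm _ (flipAt_invol i)) F
  simp only [h, Finset.sum_neg_distrib] at h1
  have : ∑ τ, F τ = 0 := by linarith
  simp [Ex, this]

theorem Ex_single (i : V) : Ex (fun τ => sg (τ i)) = 0 :=
  Ex_odd i _ (fun τ => by simp [flipAt, sg_not])

theorem Ex_pair (i j : V) : Ex (fun τ => sg (τ i) * sg (τ j)) = if i = j then 1 else 0 := by
  split_ifs with h
  · subst h; simp only [sg_mul_self]; exact Ex_const 1
  · exact Ex_odd i _ (fun τ => by simp [flipAt, sg_not, Function.update_of_ne (Ne.symm h)])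

theorem Ex_sq (c : V → ℝ) : Ex (fun τ => (∑ i, c i * sg (τ i)) ^ 2) = ∑ i, c i ^ 2 := by
  have : ∀ τ : V → Bool, (∑ i, c i * sg (τ i)) ^ 2
      = ∑ i, ∑ j, (c i * c j) * (sg (τ i) * sg (τ j)) := by
    intro τ
    rw [sq, Finset.sum_mul_sum]
    refine sum_congr rfl fun i _ => sum_congr rfl fun j _ => by ring
  simp only [this, Ex_sum, Ex_mul, Ex_pair]
  simp [sq]

/-- The random placement lemma. -/
theorem exists_signs (f : V → V → ℝ) (A : Finset V) (α σ : V → ℝ)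
    (hα : ∀ v, α v = 1 ∨ α v = -1) (hσ : ∀ v, σ v = 1 ∨ σ v = -1) (r : V → V) (lam : ℝ)
    (hl : 0 < lam) (k : V → V → ℝ)
    (hk1 : ∀ u v, u ∈ A → v ∈ A → k u v ≤ 0)
    (hk2 : ∀ u v, u ∉ A → v ∉ A → r u = r v → k u v ≤ - f u v * (σ u * σ v))
    (hk3 : ∀ u v, u ∉ A ∨ v ∉ A → ¬ (u ∉ A ∧ v ∉ A ∧ r u = r v) → k u v ≤ 0)
    (hA : ∀ u v, u ∈ A → v ∈ A → f u v = 0) :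
    ∃ s : V → ℝ, (∀ v, s v = 1 ∨ s v = -1) ∧
      (∑ u, ∑ v, f u v) / 2 + (∑ u, ∑ v, k u v) / 2
        - |∑ a ∈ A, α a * ∑ v, (f a v - f v a)| / 2
        - ((∑ i, (∑ v ∈ Aᶜ with r v = i, σ v * ∑ w, (f v w - f w v)) ^ 2) / (4 * lam) + lam) / 2
      ≤ (∑ u, ∑ v, f u v * (1 - s u * s v)) / 2 - |(∑ u, ∑ v, f u v * (s u - s v)) / 2| := by
  set g : V → ℝ := fun v => ∑ w, (f v w - f w v) with hg
  set c : V → ℝ := fun i => ∑ v ∈ Aᶜ with r v = i, σ v * g v with hc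
  set d0 : ℝ := ∑ a ∈ A, α a * g a with hd0
  let S : (V → Bool) → V → ℝ := fun τ v => if v ∈ A then α v else σ v * sg (τ (r v))
  have hS : ∀ τ v, S τ v = 1 ∨ S τ v = -1 := by
    intro τ v
    simp only [S]
    split_ifs
    · exact hα v
    · rcases hσ v with h | h <;> rcases sg_or (τ (r v)) with h' | h' <;> simp [h, h']
  have hd : ∀ τ, ∑ u, ∑ v, f u v * (S τ u - S τ v) = d0 + ∑ i, c i * sg (τ i) := by
    intro τ
    have h1 : ∑ u, ∑ v, f u v * (S τ u - S τ v) = ∑ u, S τ u * g u := by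
      simp only [mul_sub, Finset.sum_sub_distrib, hg, Finset.mul_sum]
      congr 1
      · exact sum_congr rfl fun u _ => sum_congr rfl fun v _ => mul_comm _ _
      · rw [sum_comm]
        exact sum_congr rfl fun u _ => sum_congr rfl fun v _ => mul_comm _ _
    rw [h1, ← Finset.sum_add_sum_compl A]
    congr 1
    · exact sum_congr rfl fun u hu => by simp [S, hu]
    · rw [← Finset.sum_fiberwise_of_maps_to (s := Aᶜ) (t := univ) (g := r) (by simp)]
      refine sum_congr rfl fun i _ => ?_
      simp only [hc]
      rw [Finset.sum_mul]
      refine sum_congr rfl fun v hv => ?_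
      simp only [mem_filter, mem_compl] at hv
      simp only [S, if_neg hv.1, hv.2]; ring
  let F : (V → Bool) → ℝ := fun τ => (∑ u, ∑ v, f u v * (1 - S τ u * S τ v)) / 2
    - |d0| / 2 - ((∑ i, c i * sg (τ i)) ^ 2 / (4 * lam) + lam) / 2
  obtain ⟨τ, hτ⟩ := Ex_exists F
  have hpair : ∀ u v, k u v ≤ - f u v * Ex (fun τ => S τ u * S τ v) := by
    intro u v
    by_cases hu : u ∈ A <;> by_cases hv : v ∈ A
    · simpa [hA u v hu hv] using hk1 u v hu hv
    · have : Ex (fun τ => S τ u * S τ v) = 0 := by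
        have : ∀ τ, S τ u * S τ v = (α u * σ v) * sg (τ (r v)) := fun τ => by
          simp only [S, if_pos hu, if_neg hv]; ring
        simp only [this, Ex_mul, Ex_single]; simp
      rw [this]; simpa using hk3 u v (Or.inr hv) (by tauto)
    · have : Ex (fun τ => S τ u * S τ v) = 0 := by
        have : ∀ τ, S τ u * S τ v = (σ u * α v) * sg (τ (r u)) := fun τ => by
          simp only [S, if_pos hv, if_neg hu]; ring
        simp only [this, Ex_mul, Ex_single]; simp
      rw [this]; simpa using hk3 u v (Or.inl hu) (by tauto)
    · have : Ex (fun τ => S τ u * S τ v) = (σ u * σ v) * if r u = r v then 1 else 0 := by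
        have : ∀ τ, S τ u * S τ v = (σ u * σ v) * (sg (τ (r u)) * sg (τ (r v))) := fun τ => by
          simp only [S, if_neg hv, if_neg hu]; ring
        simp only [this, Ex_mul, Ex_pair]
      rw [this]
      split_ifs with h
      · simpa using hk2 u v hu hv h
      · simpa using hk3 u v (Or.inl hu) (by tauto)
  have hEx : (∑ u, ∑ v, f u v) / 2 + (∑ u, ∑ v, k u v) / 2 - |d0| / 2
      - ((∑ i, c i ^ 2) / (4 * lam) + lam) / 2 ≤ Ex F := by
    have e1 : F = fun τ => ((1 / 2 : ℝ) * (∑ u, ∑ v, (f u v + (- f u v) * (S τ u * S τ v)))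
        - (|d0| / 2 + lam / 2)) - (1 / (8 * lam)) * (∑ i, c i * sg (τ i)) ^ 2 := by
      funext τ
      simp only [F]
      have : ∀ u v, f u v * (1 - S τ u * S τ v) = f u v + (- f u v) * (S τ u * S τ v) := by
        intros; ring
      simp only [this]
      field_simp
      ring
    rw [e1, Ex_sub, Ex_sub, Ex_mul, Ex_mul, Ex_const, Ex_sq]
    have e2 : Ex (fun τ => ∑ u, ∑ v, (f u v + (- f u v) * (S τ u * S τ v)))
        = ∑ u, ∑ v, (f u v + - f u v * Ex (fun τ => S τ u * S τ v)) := by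
      simp only [Ex_sum, Ex_add, Ex_const, Ex_mul]
    rw [e2]
    have e3 : ∑ u, ∑ v, (f u v + k u v)
        ≤ ∑ u, ∑ v, (f u v + - f u v * Ex (fun τ => S τ u * S τ v)) :=
      sum_le_sum fun u _ => sum_le_sum fun v _ => by linarith [hpair u v]
    simp only [Finset.sum_add_distrib] at e3 ⊢
    have e4 : 1 / (8 * lam) * ∑ i, c i ^ 2 = (∑ i, c i ^ 2) / (4 * lam) / 2 := by
      field_simp; ring
    rw [e4]
    linarith
  refine ⟨S τ, hS τ, hEx.trans (hτ.trans ?_)⟩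
  rw [hd τ]
  simp only [F]
  set L := ∑ i, c i * sg (τ i)
  have h1 : |(d0 + L) / 2| ≤ |d0| / 2 + |L| / 2 := by
    rw [abs_div, abs_two]
    linarith [abs_add_le d0 L]
  have h2 : |L| ≤ L ^ 2 / (4 * lam) + lam := by
    rw [← sq_abs]
    have : 0 ≤ (|L| - 2 * lam) ^ 2 / (4 * lam) := by positivity
    have e : (|L| - 2 * lam) ^ 2 / (4 * lam) = |L| ^ 2 / (4 * lam) + lam - |L| := by
      field_simp; ring
    linarith
  linarith
end

theorem exists_balance {V : Type} [Fintype V] [DecidableEq V] (A : Finset V) (g : V → ℝ) :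
    ∃ α : V → ℝ, (∀ v, α v = 1 ∨ α v = -1) ∧
      (3 * |∑ a ∈ A, α a * g a| ≤ ∑ a ∈ A, |g a| ∨
        ∃ a ∈ A, |∑ a ∈ A, α a * g a| ≤ |g a| - |∑ u ∈ A.erase a, g u|) := by
  obtain ⟨τ, -, hmin⟩ := Finset.exists_min_image (univ : Finset (V → Bool))
    (fun τ => |∑ a ∈ A, sg (τ a) * g a|) ⟨fun _ => true, mem_univ _⟩
  obtain ⟨τ, hpos, hmin⟩ : ∃ τ : V → Bool, 0 ≤ ∑ a ∈ A, sg (τ a) * g a ∧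
      ∀ τ' : V → Bool, |∑ a ∈ A, sg (τ a) * g a| ≤ |∑ a ∈ A, sg (τ' a) * g a| := by
    rcases le_total 0 (∑ a ∈ A, sg (τ a) * g a) with h | h
    · exact ⟨τ, h, fun τ' => hmin τ' (mem_univ _)⟩
    · have e : ∑ a ∈ A, sg (!τ a) * g a = - ∑ a ∈ A, sg (τ a) * g a := by
        simp [sg_not, Finset.sum_neg_distrib]
      refine ⟨fun v => !τ v, by rw [e]; linarith, fun τ' => ?_⟩
      rw [e, abs_neg]; exact hmin τ' (mem_univ _)
  refine ⟨fun v => sg (τ v), fun v => sg_or _, ?_⟩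
  set S := ∑ a ∈ A, sg (τ a) * g a with hS
  have habs : |S| = S := abs_of_nonneg hpos
  have habsx : ∀ a, |sg (τ a) * g a| = |g a| := by
    intro a; rcases sg_or (τ a) with h | h <;> simp [h]
  have hflip : ∀ a ∈ A, 0 < sg (τ a) * g a → S ≤ sg (τ a) * g a := by
    intro a ha hp
    have h1 := hmin (flipAt a τ)
    have e : ∑ u ∈ A, sg (flipAt a τ u) * g u = S - 2 * (sg (τ a) * g a) := by
      rw [hS, ← Finset.add_sum_erase A _ ha, ← Finset.add_sum_erase A (fun u => sg (τ u) * g u) ha]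
      have : ∑ u ∈ A.erase a, sg (flipAt a τ u) * g u = ∑ u ∈ A.erase a, sg (τ u) * g u :=
        sum_congr rfl fun u hu => by
          rw [flipAt, Function.update_of_ne (ne_of_mem_erase hu)]
      rw [this]
      simp only [flipAt, Function.update_self, sg_not]
      ring
    rw [e, habs] at h1
    rcases le_abs.1 h1 with h | h <;> linarith
  rw [habs]
  by_cases hex : ∃ a ∈ A, 0 < sg (τ a) * g a
  · obtain ⟨a, ha, hp⟩ := hex
    have hSa : S = sg (τ a) * g a + ∑ u ∈ A.erase a, sg (τ u) * g u := by
      rw [hS, ← Finset.add_sum_erase A _ ha]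
    by_cases hex2 : ∃ b ∈ A.erase a, 0 < sg (τ b) * g b
    · left
      obtain ⟨b, hb, hpb⟩ := hex2
      have hSb : S = sg (τ a) * g a + (sg (τ b) * g b
          + ∑ u ∈ (A.erase a).erase b, sg (τ u) * g u) := by
        rw [hSa, ← Finset.add_sum_erase (A.erase a) _ hb]
      rw [← Finset.add_sum_erase A _ ha, ← Finset.add_sum_erase (A.erase a) _ hb]
      have h1 := hflip a ha hp
      have h2 := hflip b (mem_of_mem_erase hb) hpb
      have h3 : -(∑ u ∈ (A.erase a).erase b, sg (τ u) * g u)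
          ≤ ∑ u ∈ (A.erase a).erase b, |g u| := by
        rw [← Finset.sum_neg_distrib]
        exact sum_le_sum fun u _ => by rw [← habsx u]; exact neg_le_abs _
      have h4 := habsx a
      have h5 := habsx b
      rw [abs_of_pos hp] at h4
      rw [abs_of_pos hpb] at h5
      linarith
    · right
      push Not at hex2
      refine ⟨a, ha, ?_⟩
      have h4 := habsx a
      rw [abs_of_pos hp] at h4
      have h3 : |∑ u ∈ A.erase a, g u| ≤ - ∑ u ∈ A.erase a, sg (τ u) * g u := by
        refine (Finset.abs_sum_le_sum_abs _ _).trans ?_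
        rw [← Finset.sum_neg_distrib]
        exact sum_le_sum fun u hu => by rw [← habsx u, abs_of_nonpos (hex2 u hu)]
      linarith
  · left
    push Not at hex
    have : S ≤ 0 := Finset.sum_nonpos hex
    have h0 : 0 ≤ ∑ a ∈ A, |g a| := sum_nonneg fun _ _ => abs_nonneg _
    linarith

/-- The counting step: this is where the outdegree condition enters. -/
theorem count_bound {V : Type} [Fintype V] [DecidableEq V] (e : V → V → ℝ)
    (h0 : ∀ u v, 0 ≤ e u v) (h1 : ∀ u v, e u v ≤ 1) (hout : ∀ v, 2 ≤ ∑ w, e v w)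
    (A : Finset V) (f : V → V → ℝ)
    (hfA : ∀ u v, u ∈ A → v ∈ A → f u v = 0)
    (hfB : ∀ u v, u ∉ A ∨ v ∉ A → f u v = e u v)
    (I : V → ℝ) (hI0 : ∀ v, 0 ≤ I v)
    (hI : ∀ u, u ∉ A → I u = 1 ∨ ∀ v, v ∉ A → e u v = 0) (S : ℝ)
    (hS : 3 * S ≤ ∑ a ∈ A, |∑ v, (f a v - f v a)| ∨
        ∃ a ∈ A, S ≤ |∑ v, (f a v - f v a)| - |∑ u ∈ A.erase a, ∑ v, (f u v - f v u)|) :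
    3 * S ≤ (∑ u, ∑ v, f u v) + ∑ v, I v := by
  have hrow : ∀ u ∈ A, ∑ v, f u v = ∑ b ∈ Aᶜ, e u b := by
    intro u hu
    rw [← Finset.sum_add_sum_compl A, Finset.sum_eq_zero (fun v hv => hfA u v hu hv), zero_add]
    exact sum_congr rfl fun v hv => hfB u v (Or.inr (mem_compl.1 hv))
  have hcol : ∀ u ∈ A, ∑ v, f v u = ∑ b ∈ Aᶜ, e b u := by
    intro u hu
    rw [← Finset.sum_add_sum_compl A, Finset.sum_eq_zero (fun v hv => hfA v u hv hu), zero_add]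
    exact sum_congr rfl fun v hv => hfB v u (Or.inl (mem_compl.1 hv))
  have hg : ∀ u ∈ A, ∑ v, (f u v - f v u) = ∑ b ∈ Aᶜ, e u b - ∑ b ∈ Aᶜ, e b u := by
    intro u hu
    rw [Finset.sum_sub_distrib, hrow u hu, hcol u hu]
  have hB : ∀ b ∈ Aᶜ, ∑ v, f b v = ∑ v, e b v := by
    intro b hb
    exact sum_congr rfl fun v _ => hfB b v (Or.inl (mem_compl.1 hb))
  have hm : ∑ u, ∑ v, f u v = ∑ a ∈ A, ∑ b ∈ Aᶜ, e a b + ∑ b ∈ Aᶜ, ∑ v, e b v := by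
    rw [← Finset.sum_add_sum_compl A, sum_congr rfl hrow, sum_congr rfl hB]
  have hIs : 0 ≤ ∑ v, I v := sum_nonneg fun v _ => hI0 v
  have hBs : ∑ b ∈ Aᶜ, ∑ v, e b v
      = ∑ a ∈ A, ∑ b ∈ Aᶜ, e b a + ∑ b ∈ Aᶜ, ∑ v ∈ Aᶜ, e b v := by
    rw [Finset.sum_comm (s := A), ← Finset.sum_add_distrib]
    exact sum_congr rfl fun b _ => (Finset.sum_add_sum_compl A _).symm
  have heB : 0 ≤ ∑ b ∈ Aᶜ, ∑ v ∈ Aᶜ, e b v := sum_nonneg fun _ _ => sum_nonneg fun _ _ => h0 _ _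
  rcases hS with hS | ⟨a, ha, hS⟩
  · have : ∑ a ∈ A, |∑ v, (f a v - f v a)|
        ≤ ∑ a ∈ A, (∑ b ∈ Aᶜ, e a b + ∑ b ∈ Aᶜ, e b a) := by
      refine sum_le_sum fun u hu => ?_
      rw [hg u hu]
      have x1 : 0 ≤ ∑ b ∈ Aᶜ, e u b := sum_nonneg fun _ _ => h0 _ _
      have x2 : 0 ≤ ∑ b ∈ Aᶜ, e b u := sum_nonneg fun _ _ => h0 _ _
      rw [abs_le]; constructor <;> linarith
    rw [Finset.sum_add_distrib] at this
    linarith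
  · have hgo : ∑ u ∈ A.erase a, ∑ v, (f u v - f v u)
        = ∑ u ∈ A.erase a, ∑ b ∈ Aᶜ, e u b - ∑ u ∈ A.erase a, ∑ b ∈ Aᶜ, e b u := by
      rw [← Finset.sum_sub_distrib]
      exact sum_congr rfl fun u hu => hg u (mem_of_mem_erase hu)
    rw [hg a ha, hgo] at hS
    have hWo : ∑ b ∈ Aᶜ, (1 - I b) ≤ ∑ u ∈ A.erase a, ∑ b ∈ Aᶜ, e b u := by
      rw [Finset.sum_comm]
      refine sum_le_sum fun b hb => ?_
      rcases hI b (mem_compl.1 hb) with h | h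
      · rw [h, sub_self]; exact sum_nonneg fun _ _ => h0 _ _
      · have x1 := hout b
        rw [← Finset.sum_add_sum_compl A, Finset.sum_eq_zero (s := Aᶜ)
          (fun v hv => h v (mem_compl.1 hv)), ← Finset.add_sum_erase A _ ha] at x1
        linarith [h1 b a, hI0 b]
    have hIB : ∑ b ∈ Aᶜ, I b ≤ ∑ v, I v :=
      Finset.sum_le_sum_of_subset_of_nonneg (subset_univ _) fun v _ _ => hI0 v
    have hn2 : ∑ b ∈ Aᶜ, (2 : ℝ) ≤ ∑ b ∈ Aᶜ, ∑ v, e b v := sum_le_sum fun b _ => hout b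
    have hp : ∑ b ∈ Aᶜ, e a b ≤ ∑ b ∈ Aᶜ, (1 : ℝ) := sum_le_sum fun b _ => h1 _ _
    have hq : ∑ b ∈ Aᶜ, e b a ≤ ∑ b ∈ Aᶜ, (1 : ℝ) := sum_le_sum fun b _ => h1 _ _
    have hp0 : 0 ≤ ∑ b ∈ Aᶜ, e a b := sum_nonneg fun _ _ => h0 _ _
    have hq0 : 0 ≤ ∑ b ∈ Aᶜ, e b a := sum_nonneg fun _ _ => h0 _ _
    have hWi0 : 0 ≤ ∑ u ∈ A.erase a, ∑ b ∈ Aᶜ, e u b :=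
      sum_nonneg fun _ _ => sum_nonneg fun _ _ => h0 _ _
    have hWo0 : 0 ≤ ∑ u ∈ A.erase a, ∑ b ∈ Aᶜ, e b u :=
      sum_nonneg fun _ _ => sum_nonneg fun _ _ => h0 _ _
    rw [Finset.sum_sub_distrib] at hWo
    rw [← Finset.add_sum_erase A _ ha] at hBs
    rw [← Finset.add_sum_erase A _ ha] at hm
    simp only [Finset.sum_const, nsmul_eq_mul, mul_one] at hp hq hn2 hWo
    rw [hm]
    generalize ∑ u ∈ A.erase a, ∑ b ∈ Aᶜ, e b u = Wo at *
    generalize ∑ u ∈ A.erase a, ∑ b ∈ Aᶜ, e u b = Wi at *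
    generalize ∑ b ∈ Aᶜ, e a b = p at *
    generalize ∑ b ∈ Aᶜ, e b a = q at *
    have y1 := le_abs_self (Wi - Wo)
    have y2 := neg_le_abs (Wi - Wo)
    rcases le_total q p with h | h
    · rw [abs_of_nonneg (by linarith)] at hS
      linarith
    · rw [abs_of_nonpos (by linarith)] at hS
      linarith

theorem eCount_eq {V : Type} [DecidableEq V] (E : V → V → Prop) [DecidableRel E]
    (X Y : Finset V) :
    (eCount E X Y : ℝ) = ∑ u ∈ X, ∑ v ∈ Y, if E u v then (1 : ℝ) else 0 := by
  rw [eCount, Finset.card_filter, ← Finset.sum_product']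
  push_cast
  rfl

open Classical in
theorem main_bound {V : Type} [Fintype V] (e : V → V → ℝ)
    (h01 : ∀ u v, e u v = 0 ∨ e u v = 1) (hloop : ∀ v, e v v = 0)
    (hout : ∀ v, 2 ≤ ∑ w, e v w) (D K lam M : ℝ) (hD : 0 < D) (hK : 0 < K) (hl : 0 < lam)
    (hM : M = ∑ u, ∑ v, e u v) :
    ∃ s : V → ℝ, (∀ v, s v = 1 ∨ s v = -1) ∧ ∃ f : V → V → ℝ, (∀ u v, 0 ≤ f u v ∧ f u v ≤ e u v) ∧
      M / 3 - (2 * M / D) ^ 2 / 3 - M / K - ((D + K * D) * M / (4 * lam) + lam / 2)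
      ≤ (∑ u, ∑ v, f u v * (1 - s u * s v)) / 2 - |(∑ u, ∑ v, f u v * (s u - s v)) / 2| := by
  have h0 : ∀ u v, 0 ≤ e u v := fun u v => by rcases h01 u v with h | h <;> simp [h]
  have h1 : ∀ u v, e u v ≤ 1 := fun u v => by rcases h01 u v with h | h <;> simp [h]
  set deg : V → ℝ := fun v => ∑ w, (e v w + e w v) with hdeg
  have hdeg0 : ∀ v, 0 ≤ deg v := fun v => sum_nonneg fun w _ => add_nonneg (h0 _ _) (h0 _ _)
  have hdegM : ∑ v, deg v = 2 * M := by
    simp only [hdeg, Finset.sum_add_distrib]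
    rw [Finset.sum_comm (f := fun v w => e w v), ← hM]; ring
  have hmarkov : ∀ t : ℝ, 0 < t →
      ((univ.filter fun v => t < deg v).card : ℝ) ≤ 2 * M / t := by
    intro t ht
    rw [le_div_iff₀ ht, ← hdegM]
    calc ((univ.filter fun v => t < deg v).card : ℝ) * t
        = ∑ v ∈ univ.filter fun v => t < deg v, t := by simp
      _ ≤ ∑ v ∈ univ.filter fun v => t < deg v, deg v :=
          sum_le_sum fun v hv => (mem_filter.1 hv).2.le
      _ ≤ ∑ v, deg v :=
          Finset.sum_le_sum_of_subset_of_nonneg (subset_univ _) fun v _ _ => hdeg0 v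
  set A : Finset V := univ.filter fun v => D < deg v with hA
  have hBdeg : ∀ v, v ∉ A → deg v ≤ D := fun v hv => by
    by_contra h; exact hv (by simpa [hA] using h)
  set f : V → V → ℝ := fun u v => if u ∈ A ∧ v ∈ A then 0 else e u v with hf
  have hfA : ∀ u v, u ∈ A → v ∈ A → f u v = 0 := fun u v hu hv => if_pos ⟨hu, hv⟩
  have hfB : ∀ u v, u ∉ A ∨ v ∉ A → f u v = e u v := fun u v h => if_neg (by tauto)
  have hf0 : ∀ u v, 0 ≤ f u v ∧ f u v ≤ e u v := by
    intro u v
    simp only [hf]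
    split_ifs
    · exact ⟨le_rfl, h0 _ _⟩
    · exact ⟨h0 _ _, le_rfl⟩
  have hmf : M - (2 * M / D) ^ 2 ≤ ∑ u, ∑ v, f u v := by
    have x1 : ∑ u, ∑ v, e u v
        ≤ ∑ u, ∑ v, (f u v + (if u ∈ A then 1 else 0) * (if v ∈ A then 1 else 0)) := by
      refine sum_le_sum fun u _ => sum_le_sum fun v _ => ?_
      by_cases hu : u ∈ A <;> by_cases hv : v ∈ A <;> simp [hf, hu, hv, h1]
    simp only [Finset.sum_add_distrib] at x1
    rw [← Finset.sum_mul_sum] at x1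
    have x2 : ∑ u, (if u ∈ A then (1 : ℝ) else 0) = A.card := by simp
    rw [x2, ← hM] at x1
    have x3 := hmarkov D hD
    have x4 : (0 : ℝ) ≤ A.card := Nat.cast_nonneg _
    nlinarith
  let H : V → V → Prop := fun u v => u ∉ A ∧ v ∉ A ∧ (e u v = 1 ∨ e v u = 1)
  obtain ⟨r₀, ⟨s1, s2, s3⟩, hcard⟩ := exists_starMap H
    (fun u v h => ⟨h.2.1, h.1, h.2.2.symm⟩) (fun u h => by simp [H, hloop] at h)
  let r : V → V := fun v => if K < deg v then v else r₀ v
  have hr1 : ∀ v, r v = v ∨ H v (r v) := by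
    intro v; simp only [r]; split_ifs
    · exact Or.inl rfl
    · exact s1 v
  have hr2 : ∀ v, r (r v) = r v := by
    intro v
    by_cases hv : K < deg v
    · simp [r, hv]
    · by_cases hw : K < deg (r₀ v) <;> simp [r, hv, hw, s2]
  have hne : ∀ v, r v ≠ v → deg v ≤ K ∧ r v = r₀ v := by
    intro v hv
    by_cases h : K < deg v
    · exact absurd (if_pos h) hv
    · exact ⟨not_lt.1 h, if_neg h⟩
  have hr3 : ∀ v w, r v = r w → r v ≠ v → r w ≠ w → ¬ H v w := by
    intro v w hvw hv hw
    have a1 := (hne v hv).2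
    have a2 := (hne w hw).2
    rw [a1] at hv; rw [a2] at hw; rw [a1, a2] at hvw
    exact s3 v w hvw hv hw
  set ℓ : ℝ := ((univ.filter fun v => r v ≠ v).card : ℝ) with hℓ
  have hleaves : ((univ.filter fun v => ∃ w, H v w).card : ℝ) ≤ 3 * (ℓ + 2 * M / K) := by
    have x1 : (univ.filter fun v => r₀ v ≠ v).card ≤
        (univ.filter fun v => r v ≠ v).card + (univ.filter fun v => K < deg v).card := by
      refine le_trans (card_le_card ?_) (card_union_le _ _)
      intro v hv
      have hv' : r₀ v ≠ v := by simpa using hv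
      by_cases h : K < deg v
      · exact mem_union_right _ (by simpa using h)
      · refine mem_union_left _ ?_
        simp [r, hv', not_lt.1 h]
    have x2 := hmarkov K hK
    have x1' : ((univ.filter fun v => r₀ v ≠ v).card : ℝ) ≤
        ℓ + (univ.filter fun v => K < deg v).card := by rw [hℓ]; exact_mod_cast x1
    have x3 : ((univ.filter fun v => ∃ w, H v w).card : ℝ)
        ≤ 3 * (univ.filter fun v => r₀ v ≠ v).card := by
      have : ((univ.filter fun v => ∃ w, H v w).card)
        ≤ 3 * (univ.filter fun v => r₀ v ≠ v).card := by convert hcard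
      exact_mod_cast this
    linarith
  let σ : V → ℝ := fun v => if r v = v then 1 else -1
  have hσ : ∀ v, σ v = 1 ∨ σ v = -1 := by
    intro v; simp only [σ]; split_ifs <;> simp
  obtain ⟨α, hα, hbal⟩ := exists_balance A (fun a => ∑ v, (f a v - f v a))
  let k : V → V → ℝ := fun u v => if u ∉ A ∧ v ∉ A ∧ r u = r v then e u v else 0
  obtain ⟨s, hs, hbound⟩ := exists_signs f A α σ hα hσ r lam hl k
    (fun u v hu hv => by simp [k, hu])
    (fun u v hu hv huv => by
      have x : k u v = e u v := if_pos ⟨hu, hv, huv⟩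
      rw [x, hfB u v (Or.inl hu)]
      rcases h01 u v with h | h
      · simp [h]
      · have huv' : u ≠ v := by rintro rfl; rw [hloop] at h; norm_num at h
        have hH : H u v := ⟨hu, hv, Or.inl h⟩
        by_cases c1 : r u = u <;> by_cases c2 : r v = v
        · exact absurd (by rw [← c1, huv, c2]) huv'
        · simp [σ, c1, c2]
        · simp [σ, c1, c2]
        · exact absurd hH (hr3 u v huv c1 c2))
    (fun u v _ h => by simp only [k]; rw [if_neg h])
    hfA
  refine ⟨s, hs, f, hf0, le_trans ?_ hbound⟩
  have hk : ℓ ≤ ∑ u, ∑ v, k u v := by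
    have x1 : ∀ u v, (if r u = v then (if r u ≠ u then e u v else 0) else 0)
        + (if r v = u then (if r v ≠ v then e u v else 0) else 0) ≤ k u v := by
      intro u v
      have k0 : 0 ≤ k u v := by simp only [k]; split_ifs <;> simp [h0]
      have kk : ∀ u v, r u = v → r u ≠ u → k u v = e u v ∧ k v u = e v u := by
        intro u v huv hu
        have hH : H u v := by rw [← huv]; exact (hr1 u).resolve_left hu
        have hrr : r u = r v := by rw [← huv, hr2]
        exact ⟨if_pos ⟨hH.1, hH.2.1, hrr⟩, if_pos ⟨hH.2.1, hH.1, hrr.symm⟩⟩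
      by_cases c1 : r u = v ∧ r u ≠ u
      · have c2 : ¬ (r v = u) := by
          rintro h
          rw [← c1.1, hr2] at h
          exact c1.2 h
        rw [if_pos c1.1, if_pos c1.2, if_neg c2, add_zero, (kk u v c1.1 c1.2).1]
      · have z : (if r u = v then (if r u ≠ u then e u v else 0) else 0) = 0 := by
          split_ifs <;> tauto
        rw [z, zero_add]
        by_cases c2 : r v = u ∧ r v ≠ v
        · rw [if_pos c2.1, if_pos c2.2, (kk v u c2.1 c2.2).2]
        · have z : (if r v = u then (if r v ≠ v then e u v else 0) else 0) = 0 := by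
            split_ifs <;> tauto
          rw [z]; exact k0
    have x2 := sum_le_sum fun u (_ : u ∈ univ) => sum_le_sum fun v (_ : v ∈ univ) => x1 u v
    refine le_trans ?_ x2
    simp only [Finset.sum_add_distrib]
    rw [Finset.sum_comm (f := fun u v => if r v = u then (if r v ≠ v then e u v else 0) else 0)]
    simp only [Finset.sum_ite_eq, mem_univ, if_true]
    rw [← Finset.sum_add_distrib, hℓ, Finset.card_filter]
    push_cast
    refine sum_le_sum fun v _ => ?_
    split_ifs with hv
    · have hH : H v (r v) := (hr1 v).resolve_left hv
      rcases hH.2.2 with h | h <;> rw [h] <;> linarith [h0 v (r v), h0 (r v) v]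
    · simp
  have hdf : ∀ v, |∑ w, (f v w - f w v)| ≤ deg v := by
    intro v
    refine (Finset.abs_sum_le_sum_abs _ _).trans (sum_le_sum fun w _ => ?_)
    have y1 := hf0 v w
    have y2 := hf0 w v
    rw [abs_le]; constructor <;> linarith
  have hc1 : ∀ i, |∑ v ∈ Aᶜ with r v = i, σ v * ∑ w, (f v w - f w v)|
      ≤ ∑ v ∈ Aᶜ with r v = i, deg v := by
    intro i
    refine (Finset.abs_sum_le_sum_abs _ _).trans (sum_le_sum fun v _ => ?_)
    rw [abs_mul]
    have : |σ v| = 1 := by rcases hσ v with h | h <;> simp [h]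
    rw [this, one_mul]; exact hdf v
  have hc2 : ∀ i, ∑ v ∈ Aᶜ with r v = i, deg v ≤ D + K * D := by
    intro i
    by_cases hi : i ∈ A
    · rw [Finset.sum_eq_zero]
      · positivity
      · intro v hv
        simp only [mem_filter, mem_compl] at hv
        exfalso
        rcases hr1 v with h | h
        · rw [← hv.2, h] at hi; exact hv.1 hi
        · rw [hv.2] at h; exact h.2.1 hi
    · have y1 : ∑ v ∈ Aᶜ with r v = i, deg v
          ≤ ∑ v, ((if v = i then deg v else 0) + K * (e i v + e v i)) := by
        rw [Finset.sum_filter]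
        refine le_trans ?_ (sum_le_sum_of_subset_of_nonneg (subset_univ Aᶜ) ?_)
        · refine sum_le_sum fun v hv => ?_
          have kn : 0 ≤ K * (e i v + e v i) := mul_nonneg hK.le (add_nonneg (h0 _ _) (h0 _ _))
          by_cases c : r v = i
          · rw [if_pos c]
            by_cases c' : v = i
            · rw [if_pos c']; linarith
            · have c'' : r v ≠ v := by rw [c]; exact fun h => c' h.symm
              have hH : H v i := by rw [← c]; exact (hr1 v).resolve_left c''
              have dk := (hne v c'').1
              rw [if_neg c', zero_add]
              have : 1 ≤ e i v + e v i := by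
                rcases hH.2.2 with h | h <;> rw [h] <;> linarith [h0 i v, h0 v i]
              nlinarith
          · rw [if_neg c]
            have : 0 ≤ if v = i then deg v else 0 := by split_ifs <;> simp [hdeg0]
            linarith
        · intro v _ _
          have kn : 0 ≤ K * (e i v + e v i) := mul_nonneg hK.le (add_nonneg (h0 _ _) (h0 _ _))
          have : 0 ≤ if v = i then deg v else 0 := by split_ifs <;> simp [hdeg0]
          linarith
      have y2 : ∑ v, ((if v = i then deg v else 0) + K * (e i v + e v i))
          = deg i + K * deg i := by
        rw [Finset.sum_add_distrib, ← Finset.mul_sum]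
        simp [hdeg]
      have y3 := hBdeg i hi
      rw [y2] at y1
      nlinarith
  have hvar : ∑ i, (∑ v ∈ Aᶜ with r v = i, σ v * ∑ w, (f v w - f w v)) ^ 2
      ≤ (D + K * D) * (2 * M) := by
    have hsum : ∑ i, ∑ v ∈ Aᶜ with r v = i, deg v ≤ 2 * M := by
      have hfib : ∑ i, ∑ v ∈ Aᶜ with r v = i, deg v = ∑ v ∈ Aᶜ, deg v := by
        convert Finset.sum_fiberwise_of_maps_to (s := Aᶜ) (t := univ) (g := r)
          (fun v _ => mem_univ _) deg
      rw [hfib, ← hdegM]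
      exact Finset.sum_le_sum_of_subset_of_nonneg (subset_univ _) fun v _ _ => hdeg0 v
    have hDK : 0 ≤ D + K * D := by positivity
    refine le_trans ?_ (mul_le_mul_of_nonneg_left hsum hDK)
    rw [Finset.mul_sum]
    refine sum_le_sum fun i _ => ?_
    rw [← sq_abs, sq]
    exact mul_le_mul ((hc1 i).trans (hc2 i)) (hc1 i) (abs_nonneg _) hDK
  have hcount := count_bound e h0 h1 hout A f hfA hfB (fun v => if ∃ w, H v w then 1 else 0)
    (fun v => by split_ifs <;> simp)
    (fun u hu => by
      by_cases h : ∃ w, H u w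
      · left; simp [h]
      · right
        intro v hv
        rcases h01 u v with h' | h'
        · exact h'
        · exact absurd ⟨v, hu, hv, Or.inl h'⟩ h)
    _ hbal
  have hN : ∑ v, (if ∃ w, H v w then (1 : ℝ) else 0)
      = ((univ.filter fun v => ∃ w, H v w).card : ℝ) := by
    rw [Finset.card_filter]; push_cast; rfl
  rw [hN] at hcount
  have hvar' : (∑ i, (∑ v ∈ Aᶜ with r v = i, σ v * ∑ w, (f v w - f w v)) ^ 2) / (4 * lam)
      ≤ (D + K * D) * (2 * M) / (4 * lam) := by gcongr
  have hv2 : (D + K * D) * (2 * M) / (4 * lam) = 2 * ((D + K * D) * M / (4 * lam)) := by ring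
  have hk2 : 2 * M / K = 2 * (M / K) := by ring
  rw [hk2] at hleaves
  linarith

/-- From signs to a bipartition. -/
theorem main_partition {V : Type} [Fintype V] [DecidableEq V] (E : V → V → Prop) [DecidableRel E]
    (hloop : ∀ v, ¬ E v v) (hout : ∀ v, 2 ≤ outDeg E v) (D K lam : ℝ) (hD : 0 < D)
    (hK : 0 < K) (hl : 0 < lam) (M : ℝ) (hM : M = (eCount E univ univ : ℝ)) :
    ∃ V1 : Finset V,
      (M / 3 - (2 * M / D) ^ 2 / 3 - M / K - ((D + K * D) * M / (4 * lam) + lam / 2)) / 2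
        ≤ min (eCount E V1 V1ᶜ : ℝ) (eCount E V1ᶜ V1 : ℝ) := by
  obtain ⟨s, hs, f, hf, hb⟩ := main_bound (fun u v => if E u v then (1 : ℝ) else 0)
    (fun u v => by split_ifs <;> simp) (fun v => by simp [hloop])
    (fun v => by have := hout v; simp only [outDeg] at this; simp; exact_mod_cast this)
    D K lam M hD hK hl (by rw [hM, eCount_eq])
  refine ⟨univ.filter fun v => s v = 1, ?_⟩
  have key : ∀ X : Finset V, ∀ t : V → ℝ, (∀ v, v ∈ X → t v = 1) → (∀ v, v ∉ X → t v = -1) →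
      (∑ u, ∑ v, f u v * (1 - t u * t v)) / 4 + (∑ u, ∑ v, f u v * (t u - t v)) / 4
        ≤ (eCount E X Xᶜ : ℝ) := by
    intro X t h1 h2
    rw [eCount_eq, ← add_div, ← Finset.sum_add_distrib, Finset.sum_div]
    simp only [← Finset.sum_add_distrib, Finset.sum_div]
    rw [← Finset.sum_subset (subset_univ X)]
    · refine sum_le_sum fun u hu => ?_
      rw [← Finset.sum_subset (subset_univ Xᶜ)]
      · refine sum_le_sum fun v hv => ?_
        rw [h1 u hu, h2 v (mem_compl.1 hv)]
        have := (hf u v).2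
        linarith
      · intro v _ hv
        rw [h1 u hu, h1 v (by simpa using hv)]; ring
    · intro u _ hu
      refine Finset.sum_eq_zero fun v _ => ?_
      rw [h2 u hu]; ring
  have k1 := key (univ.filter fun v => s v = 1) s (by simp)
    (fun v hv => (hs v).resolve_left (by simpa using hv))
  have k2 := key (univ.filter fun v => s v = 1)ᶜ (fun v => - s v)
    (fun v hv => by rw [(hs v).resolve_left (by simpa using hv)]; norm_num)
    (fun v hv => by
      have : s v = 1 := by simpa using hv
      rw [this])
  rw [compl_compl] at k2
  have e1 : ∑ u, ∑ v, f u v * (1 - -s u * -s v) = ∑ u, ∑ v, f u v * (1 - s u * s v) :=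
    sum_congr rfl fun u _ => sum_congr rfl fun v _ => by ring
  have e2 : ∑ u, ∑ v, f u v * (-s u - -s v) = - ∑ u, ∑ v, f u v * (s u - s v) := by
    rw [← Finset.sum_neg_distrib]
    refine sum_congr rfl fun u _ => ?_
    rw [← Finset.sum_neg_distrib]
    exact sum_congr rfl fun v _ => by ring
  rw [e1, e2] at k2
  have a1 := le_abs_self ((∑ u, ∑ v, f u v * (s u - s v)) / 2)
  have a2 := neg_le_abs ((∑ u, ∑ v, f u v * (s u - s v)) / 2)
  rw [le_min_iff]
  constructor <;> linarith

/-- Main theorem for `d = 2`: for every `ε > 0`, every directed graph with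
sufficiently many edges `m` and minimum outdegree at least 2 admits a
bipartition `V = V₁ ∪ V₂` with `min{e(V₁,V₂), e(V₂,V₁)} ≥ (1/6 − ε)m`. -/
theorem stmt18 (ε : ℝ) (hε : 0 < ε) :
    ∃ m0 : ℕ, ∀ (V : Type) (iF : Fintype V) (iD : DecidableEq V)
        (E : V → V → Prop) (iR : DecidableRel E),
      (∀ v, ¬ E v v) →
      (∀ v, 2 ≤ @outDeg V iF E iR v) →
      m0 ≤ @eCount V iD E iR Finset.univ Finset.univ →
      ∃ V1 : Finset V,
        (1 / 6 - ε) * (@eCount V iD E iR Finset.univ Finset.univ : ℝ)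
          ≤ min ((@eCount V iD E iR V1 V1ᶜ : ℕ) : ℝ)
              ((@eCount V iD E iR V1ᶜ V1 : ℕ) : ℝ) := by
  set K : ℝ := 2 / ε with hKdef
  have hK : 0 < K := by positivity
  set a : ℝ := 4 / ε + 1 with hadef
  have ha : 0 < a := by positivity
  have ha2 : 4 / ε ≤ a ^ 2 := by
    have : 0 < 4 / ε := by positivity
    nlinarith
  set R0 : ℝ := a * (1 + K) / ε ^ 2 with hR0
  have hR0pos : 0 < R0 := by positivity
  refine ⟨⌈R0 ^ 2⌉₊ + 1, ?_⟩
  intro V iF iD E iR hloop hout hm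
  have hM : R0 ^ 2 + 1 ≤ (eCount E univ univ : ℝ) := by
    have h1 : R0 ^ 2 ≤ (⌈R0 ^ 2⌉₊ : ℝ) := Nat.le_ceil _
    have h2 : ((⌈R0 ^ 2⌉₊ + 1 : ℕ) : ℝ) ≤ (eCount E univ univ : ℝ) := by exact_mod_cast hm
    push_cast at h2
    linarith
  obtain ⟨M, hMdef⟩ : ∃ M : ℝ, M = (eCount E univ univ : ℝ) := ⟨_, rfl⟩
  rw [← hMdef] at hM ⊢
  have hMpos : 0 < M := by nlinarith [sq_nonneg R0]
  set R : ℝ := Real.sqrt M with hRdef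
  have hR2 : R ^ 2 = M := Real.sq_sqrt hMpos.le
  have hRpos : 0 < R := Real.sqrt_pos.2 hMpos
  have hRR : R0 ≤ R := Real.le_sqrt_of_sq_le (by linarith)
  obtain ⟨V1, hV1⟩ := main_partition E hloop hout (a * R) K (ε * M) (by positivity) hK
    (by positivity) M hMdef
  refine ⟨V1, le_trans ?_ hV1⟩
  have t1 : (2 * M / (a * R)) ^ 2 ≤ ε * M := by
    have : (2 * M / (a * R)) ^ 2 = 4 * M / a ^ 2 := by
      rw [← hR2]; field_simp; ring
    rw [this, div_le_iff₀ (by positivity)]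
    rw [div_le_iff₀ hε] at ha2
    nlinarith
  have t2 : M / K = ε * M / 2 := by
    rw [hKdef]; field_simp
  have t3 : (a * R + K * (a * R)) * M / (4 * (ε * M)) ≤ ε * M / 4 := by
    rw [div_le_iff₀ (by positivity)]
    have h1 : a * (1 + K) ≤ R * ε ^ 2 := by
      rw [hR0, div_le_iff₀ (by positivity)] at hRR
      exact hRR
    have h2 : a * (1 + K) * (R * M) ≤ R * ε ^ 2 * (R * M) :=
      mul_le_mul_of_nonneg_right h1 (by positivity)
    have h3 : R * ε ^ 2 * (R * M) = ε ^ 2 * M * M := by rw [← hR2]; ring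
    nlinarith
  have := mul_pos hε hMpos
  rw [t2]
  linarith
end
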